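/- arXiv:1807.00658 — 2 statements merged into one kernel-verified Lean document; each statement's English description precedes it below -/
import Mathlib

section
/- Let I* be the three-element linearly ordered poset ({0,p,1}, ⪯, ⊏) with 0 ⊏ p ⊏ 1, 0 ≺ 1, and p incomparable (with respect to ⪯) to both 0 and 1. Let K be the class of all linearly ordered posets that are finite or countably infinite of order type ω and that do not embed I*. Then there exists a countably infinite linearly ordered poset Q ∈ K such that: (a) every member of K embeds into Q; and (b) every finite member A of K has finite big Ramsey degree in Q, i.e., there exists a positive integer T such that for every k ≥ 2 and every coloring χ of the set of embeddings of A into Q with k colors there is an embedding w of Q into itself such that {χ(w ∘ f) : f an embedding of A into Q} has at most T elements. -/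
/-- `(A, pa, la)` is a linearly ordered poset: `pa` is a partial order, `la` a
linear order extending it (`x ≺ y → x ⊏ y`). -/
def LOPoset {A : Type} (pa la : A → A → Prop) : Prop :=
  IsPartialOrder A pa ∧ IsStrictTotalOrder A la ∧
    ∀ x y, pa x y → x ≠ y → la x y

/-- An embedding of linearly ordered posets: an injective map preserving and
reflecting both the partial order and the linear order. -/
def LOPEmb {A B : Type} (pa la : A → A → Prop) (pb lb : B → B → Prop)
    (f : A → B) : Prop :=
  Function.Injective f ∧ (∀ x y, pa x y ↔ pb (f x) (f y)) ∧
    (∀ x y, la x y ↔ lb (f x) (f y))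

/-- The partial order of the three-element linearly ordered poset `I*`
(on vertices `0 ⊏ p=1 ⊏ 2`): `0 ≺ 2` and `1` incomparable to both. -/
def pIStar : Fin 3 → Fin 3 → Prop := fun a b => a = b ∨ (a = 0 ∧ b = 2)

/-- The linear order of `I*`. -/
def lIStar : Fin 3 → Fin 3 → Prop := fun a b => a < b

/-- `(A, pa, la)` embeds the three-element linearly ordered poset `I*`. -/
def EmbedsIStar {A : Type} (pa la : A → A → Prop) : Prop :=
  ∃ f : Fin 3 → A, LOPEmb pIStar lIStar pa la f

/-- Membership in the class `K`: a linearly ordered poset which is finite or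
countably infinite of order type `ω`, and which does not embed `I*`. -/
def MemK {A : Type} (pa la : A → A → Prop) : Prop :=
  LOPoset pa la ∧
    (Finite A ∨ ∃ e : A ≃ ℕ, ∀ x y, la x y ↔ e x < e y) ∧
    ¬ EmbedsIStar pa la


def SMap {α : Type} (W : List α → List α) : Prop :=
  (∀ u v, u.length = v.length → (W u).length = (W v).length) ∧
  ∀ u b, W u ++ [b] <+: W (u ++ [b])

namespace SMap
variable {α : Type} {W V : List α → List α}

theorem id : SMap (fun u : List α => u) := ⟨fun _ _ h => h, fun _ _ => List.prefix_rfl⟩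

theorem mono (h : SMap W) {u v : List α} (huv : u <+: v) : W u <+: W v := by
  obtain ⟨t, rfl⟩ := huv
  induction t using List.reverseRecOn with
  | nil => simp
  | append_singleton t b ih =>
    rw [← List.append_assoc]
    exact ih.trans ((List.prefix_append _ _).trans (h.2 _ b))

theorem ext (h : SMap W) {u v : List α} {b : α} (huv : u ++ [b] <+: v) : W u ++ [b] <+: W v :=
  (h.2 u b).trans (h.mono huv)

theorem comp (hW : SMap W) (hV : SMap V) : SMap (W ∘ V) :=
  ⟨fun _ _ e => hW.1 _ _ (hV.1 _ _ e), fun u b => hW.ext (hV.2 u b)⟩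

theorem length_lt (h : SMap W) {u v : List α} (huv : u.length < v.length) :
    (W u).length < (W v).length := by
  have h1 : (v.take u.length) ++ [v[u.length]] <+: v := by
    rw [List.take_append_getElem]
    exact List.take_prefix _ _
  have h2 := (h.ext h1).length_le
  have h3 := h.1 u (v.take u.length) (by simp; omega)
  simp at h2
  omega

theorem length_le (h : SMap W) (u : List α) : u.length ≤ (W u).length := by
  induction u using List.reverseRecOn with
  | nil => simp
  | append_singleton t b ih =>
    have := (h.2 t b).length_le
    simp at this ⊢
    omega

theorem inj (h : SMap W) : ∀ {u v : List α}, u.length = v.length → W u = W v → u = v := by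
  intro u
  induction u using List.reverseRecOn with
  | nil => intro v hl _; exact (List.length_eq_zero_iff.1 hl.symm).symm
  | append_singleton t b ih =>
    intro v hl he
    induction v using List.reverseRecOn with
    | nil => simp at hl
    | append_singleton s c _ =>
      have hl' : t.length = s.length := by simpa using hl
      have h1 := h.2 t b
      have h2 := h.2 s c
      rw [← he] at h2
      have h3 : W t ++ [b] = W s ++ [c] := by
        have := List.prefix_of_prefix_length_le h1 h2 (by simp [h.1 _ _ hl'])
        exact this.eq_of_length (by simp [h.1 _ _ hl'])
      obtain ⟨h4, h5⟩ := List.append_inj' h3 rfl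
      rw [ih hl' h4]
      simpa using h5
end SMap

/-! Carlson–Simpson -/
section CS
variable {α : Type}

def substW (x : List (Option α)) (a : α) : List α := x.map (·.getD a)

def preW : List (Option α) → List α
  | [] => []
  | none :: _ => []
  | some a :: x => a :: preW x

theorem preW_prefix (x : List (Option α)) (hx : none ∈ x) (a : α) :
    preW x ++ [a] <+: substW x a := by
  induction x with
  | nil => simp at hx
  | cons o x ih =>
    cases o with
    | none => simp [preW, substW]
    | some b =>
      have := ih (by simpa using hx)
      simpa [preW, substW] using this

theorem preW_map {Γ : Type} (π : α → Γ) (x : List (Option α)) {a a' : α} (h : π a = π a') :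
    (substW x a).map π = (substW x a').map π := by
  simp only [substW, List.map_map]
  apply List.map_congr_left
  intro o _
  cases o <;> simp [h]

def HasLine (P : Set (List α)) : Prop :=
  ∃ x : List (Option α), none ∈ x ∧ ∀ a, substW x a ∈ P

theorem hj [Finite α] {κ : Type} [Finite κ] (C : List α → κ) :
    ∃ x : List (Option α), none ∈ x ∧ ∃ c, ∀ a, C (substW x a) = c := by
  obtain ⟨ι, _, hι⟩ := Combinatorics.Line.exists_mono_in_high_dimension α κ
  let e := Fintype.equivFin ι
  obtain ⟨l, c, hl⟩ := hι (fun f => C (List.ofFn (fun i => f (e.symm i))))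
  refine ⟨List.ofFn (fun i => l.idxFun (e.symm i)), ?_, c, fun a => ?_⟩
  · obtain ⟨i, hi⟩ := l.proper
    rw [List.mem_ofFn]
    exact ⟨e i, by simpa using hi⟩
  · rw [← hl a]
    simp only [substW, List.map_ofFn]
    rfl

attribute [local instance] Ultrafilter.mul Ultrafilter.semigroup

theorem exists_line_idem [Finite α] : ∃ w : Ultrafilter (FreeMonoid α), w * w = w ∧
    ∀ P : Set (FreeMonoid α), P ∈ w → HasLine (α := α) P := by
  let H : Set (Ultrafilter (FreeMonoid α)) := {w | ∀ P : Set (FreeMonoid α), P ∈ w → HasLine (α := α) P}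
  have hne : H.Nonempty := by
    let S : Set (Set (FreeMonoid α)) := {s | ¬ HasLine (α := α) sᶜ}
    have : (Filter.generate S).NeBot := by
      rw [Filter.generate_neBot_iff]
      intro t ht hf
      by_contra hcon
      rw [Set.not_nonempty_iff_eq_empty] at hcon
      have hcol : ∀ s : FreeMonoid α, ∃ p : t, s ∉ p.1 := by
        intro s
        by_contra! h
        have : s ∈ ⋂₀ t := fun p hp => h ⟨p, hp⟩
        rw [hcon] at this
        exact this
      choose C hC using hcol
      have := hf.to_subtype
      obtain ⟨x, hx, c, hc⟩ := hj (α := α) C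
      refine ht c.2 ⟨x, hx, fun a => ?_⟩
      have := hC (substW x a)
      erw [hc a] at this
      exact this
    refine ⟨Ultrafilter.of (Filter.generate S), fun P hP => ?_⟩
    by_contra hl
    have h1 : Pᶜ ∈ Filter.generate S := Filter.mem_generate_of_mem (fun h => hl (by
      obtain ⟨x, hx, hh⟩ := h
      exact ⟨x, hx, fun a => not_not.1 (hh a)⟩))
    have h2 := Ultrafilter.of_le _ h1
    exact Ultrafilter.compl_notMem_iff.2 hP h2
  have hcl : IsClosed H := by
    have : H = ⋂ P ∈ {P : Set (FreeMonoid α) | ¬ HasLine (α := α) P}, {w : Ultrafilter (FreeMonoid α) | Pᶜ ∈ w} := by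
      ext w
      simp only [H, Set.mem_iInter, Set.mem_ofPred_eq, Ultrafilter.compl_mem_iff_notMem]
      exact forall_congr' fun P => ⟨fun h h1 h2 => h1 (h h2), fun h h1 => by
        by_contra h2; exact h h2 h1⟩
    rw [this]
    exact isClosed_biInter fun P _ => ultrafilter_isClosed_basic _
  have hmul : ∀ x ∈ H, ∀ y ∈ H, x * y ∈ H := by
    intro u hu v hv P hP
    have h1 : ∀ᶠ s in (u : Filter (FreeMonoid α)), ∀ᶠ t in (v : Filter (FreeMonoid α)), s * t ∈ P :=
      (Ultrafilter.eventually_mul u v (· ∈ P)).1 hP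
    obtain ⟨s, hs⟩ := h1.exists
    obtain ⟨x, hx, hx'⟩ := hv _ hs
    refine ⟨(FreeMonoid.toList s).map some ++ x, by simp [hx], fun a => ?_⟩
    have := hx' a
    have h3 : substW ((FreeMonoid.toList s).map some ++ x) a = FreeMonoid.toList s ++ substW x a := by
      simp [substW, Function.comp_def]
    rw [h3]
    exact this
  obtain ⟨w, hw, hww⟩ := exists_idempotent_in_compact_subsemigroup
    (Ultrafilter.continuous_mul_left) H hne hcl.isCompact hmul
  exact ⟨w, hww, hw⟩

theorem exists_line_idem' [Finite α] : ∃ w : Ultrafilter (List α),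
    (∀ p : List α → Prop, (∀ᶠ s in (w : Filter (List α)), p s) ↔
      ∀ᶠ s in (w : Filter (List α)), ∀ᶠ t in (w : Filter (List α)), p (s ++ t)) ∧
    ∀ P : Set (List α), P ∈ w → HasLine P := by
  obtain ⟨w, hw, hline⟩ := exists_line_idem (α := α)
  refine ⟨w, fun p => ?_, hline⟩
  have := Ultrafilter.eventually_mul w w p
  rw [hw] at this
  exact this

theorem carlson_simpson [Finite α] {κ : Type} [Finite κ] (C : List α → κ) :
    ∃ Φ : List α → List α, ∃ c0, (∀ t b, Φ t ++ [b] <+: Φ (t ++ [b])) ∧ (∀ t, C (Φ t) = c0) ∧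
      ∀ (Γ : Type) (π : α → Γ) t t', t.map π = t'.map π → (Φ t).map π = (Φ t').map π := by
  obtain ⟨w, hidem, hline⟩ := exists_line_idem' (α := α)
  let L : Set (List α) → Set (List (Option α)) := fun P => {x | none ∈ x ∧ ∀ a, substW x a ∈ P}
  have hLm : Monotone L := fun P P' h x hx => ⟨hx.1, fun a => h (hx.2 a)⟩
  have : ((w : Filter (List α)).lift' L).NeBot := by
    rw [Filter.lift'_neBot_iff hLm]
    intro P hP
    exact hline P hP
  let v := Ultrafilter.of ((w : Filter (List α)).lift' L)
  have hv : ∀ P : List α → Prop, (∀ᶠ s in (w : Filter (List α)), P s) →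
      ∀ᶠ x in (v : Filter (List (Option α))), none ∈ x ∧ ∀ a, P (substW x a) := by
    intro P hP
    exact Ultrafilter.of_le _ (Filter.mem_lift' hP)
  have hcol : ∀ {X : Type} (u : Ultrafilter X) (f : X → κ), ∃ c, ∀ᶠ x in (u : Filter X), f x = c := by
    intro X u f
    have : ∀ᶠ x in (u : Filter X), ∃ c ∈ (Set.univ : Set κ), f x = c := by simp
    rw [Ultrafilter.eventually_exists_mem_iff Set.finite_univ] at this
    obtain ⟨c, _, hc⟩ := this
    exact ⟨c, hc⟩
  choose d hd using fun s : List α => hcol v (fun x => C (s ++ preW x))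
  obtain ⟨c0, hc0⟩ := hcol w d
  let P : List α → Prop := fun s => ∀ᶠ x in (v : Filter (List (Option α))), C (s ++ preW x) = c0
  have hP : ∀ᶠ s in (w : Filter (List α)), P s := by
    filter_upwards [hc0] with s hs
    have h := hd s
    rw [hs] at h
    exact h
  let Ps : List α → Prop := fun s => P s ∧ ∀ᶠ t in (w : Filter (List α)), P (s ++ t)
  have hPs : ∀ᶠ s in (w : Filter (List α)), Ps s := hP.and ((hidem P).1 hP)
  have hPs2 : ∀ s, Ps s → ∀ᶠ t in (w : Filter (List α)), Ps (s ++ t) := by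
    intro s hs
    refine hs.2.and ?_
    have := (hidem (fun t => P (s ++ t))).1 hs.2
    simpa only [List.append_assoc] using this
  have step : ∀ F : {F : Set (List α) // F.Finite ∧ ∀ s ∈ F, Ps s}, ∃ x : List (Option α),
      none ∈ x ∧ ∀ s ∈ F.1, C (s ++ preW x) = c0 ∧ ∀ a, Ps (s ++ substW x a) := by
    rintro ⟨F, hF, hFs⟩
    have h0 : ∀ᶠ x in (v : Filter (List (Option α))), none ∈ x :=
      (hv (fun _ => True) (by simp)).mono fun x hx => hx.1
    have h1 : ∀ᶠ x in (v : Filter (List (Option α))), ∀ s ∈ F, C (s ++ preW x) = c0 ∧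
        ∀ a, Ps (s ++ substW x a) := by
      rw [Filter.eventually_all_finite hF]
      intro s hs
      exact (hFs s hs).1.and ((hv _ (hPs2 s (hFs s hs))).mono fun x hx => hx.2)
    exact (h0.and h1).exists
  choose nx hnx1 hnx2 using step
  let St := {F : Set (List α) // F.Finite ∧ ∀ s ∈ F, Ps s}
  let nextF : St → St := fun F => ⟨⋃ s ∈ F.1, Set.range fun a => s ++ substW (nx F) a,
    F.2.1.biUnion fun s _ => Set.finite_range _, by
      intro s hs
      simp only [Set.mem_iUnion, Set.mem_range] at hs
      obtain ⟨s', hs', a, rfl⟩ := hs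
      exact (hnx2 F s' hs').2 a⟩
  obtain ⟨s0, hs0⟩ := hPs.exists
  let F : ℕ → St := fun n => nextF^[n] ⟨{s0}, Set.finite_singleton _, by simpa using hs0⟩
  have hF : ∀ n, F (n + 1) = nextF (F n) := fun n => Function.iterate_succ_apply' _ _ _
  let x : ℕ → List (Option α) := fun n => nx (F n)
  let rec' : List α → ℕ → List α := fun t => List.rec (fun n => preW (x n))
    (fun a _ r n => substW (x n) a ++ r (n + 1)) t
  have g0 : ∀ n, rec' [] n = preW (x n) := fun _ => rfl
  have g1 : ∀ a t n, rec' (a :: t) n = substW (x n) a ++ rec' t (n + 1) := fun _ _ _ => rfl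
  clear_value rec'
  refine ⟨fun t => s0 ++ rec' t 0, c0, ?_, ?_, ?_⟩
  · intro t b
    rw [List.append_assoc, List.prefix_append_right_inj]
    generalize 0 = n
    induction t generalizing n with
    | nil =>
      simp only [g0, g1, List.nil_append]
      exact (preW_prefix _ (hnx1 _) b).trans (List.prefix_append _ _)
    | cons a t ih =>
      simp only [g1, List.cons_append, List.append_assoc, List.prefix_append_right_inj]
      exact ih _
  · intro t
    have key : ∀ t n, ∀ s ∈ (F n).1, C (s ++ rec' t n) = c0 := by
      intro t
      induction t with
      | nil => intro n s hs; rw [g0]; exact (hnx2 (F n) s hs).1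
      | cons a t ih =>
        intro n s hs
        rw [g1, ← List.append_assoc]
        apply ih
        rw [hF]
        simp only [nextF, Set.mem_iUnion, Set.mem_range]
        exact ⟨s, hs, a, rfl⟩
    exact key t 0 s0 rfl
  · intro Γ π t t' h
    simp only [List.map_append, List.append_cancel_left_eq]
    generalize 0 = n
    induction t generalizing t' n with
    | nil =>
      have : t' = [] := by simpa using h.symm
      rw [this]
    | cons a t ih =>
      cases t' with
      | nil => simp at h
      | cons a' t' =>
        simp only [List.map_cons, List.cons.injEq] at h
        simp only [g1, List.map_append, ih t' h.2, preW_map π (x n) h.1]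
end CS

/-! Halpern–Läuchli for all nodes of a level -/
section Tree

theorem finite_lists_lt (m : ℕ) : Finite {u : List Bool // u.length < m} :=
  (List.finite_length_lt Bool m).to_subtype

theorem finite_lists_eq (m : ℕ) : Finite {u : List Bool // u.length = m} :=
  (List.finite_length_eq Bool m).to_subtype

theorem halpern_lauchli {κ : Type} [Finite κ] (l : ℕ) (c : (List Bool → List Bool) → κ) :
    ∃ W : List Bool → List Bool, SMap W ∧ (∀ u, u.length < l → W u = u) ∧ ∃ c0,
      ∀ (σ : List Bool → List Bool) (N : ℕ), (∀ q, (σ q).length = N) →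
        c (fun q => if q.length = l then W (q ++ σ q) else []) = c0 := by
  classical
  let D := {u : List Bool // u.length = l}
  have : Finite D := finite_lists_eq l
  let ev : List Bool → (D → Bool) → Bool := fun q f => if h : q.length = l then f ⟨q, h⟩ else false
  obtain ⟨Φ, c0, h1, h2, h3⟩ := carlson_simpson (α := D → Bool)
    (fun t => c (fun q => if q.length = l then q ++ t.map (ev q) else []))
  let W : List Bool → List Bool := fun u => if u.length < l then u else
    u.take l ++ (Φ ((u.drop l).map (fun b _ => b))).map (ev (u.take l))
  have hlen : ∀ t t', t.length = t'.length → (Φ t).length = (Φ t').length := by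
    intro t t' h
    have := h3 Unit (fun _ => ()) t t' (by simp [h])
    simpa using congrArg List.length this
  have hWlt : ∀ u, u.length < l → W u = u := fun u hu => by simp [W, hu]
  have hWge : ∀ q t : List Bool, q.length = l →
      W (q ++ t) = q ++ (Φ (t.map (fun b _ => b))).map (ev q) := by
    intro q t hq
    have : ¬ (q ++ t).length < l := by simp; omega
    simp only [W, this, if_false]
    subst hq
    simp
  refine ⟨W, ⟨?_, ?_⟩, hWlt, c0, ?_⟩
  · intro u v h
    by_cases hu : u.length < l
    · rw [hWlt u hu, hWlt v (h ▸ hu), h]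
    · have hv : ¬ v.length < l := h ▸ hu
      simp only [W, hu, hv, if_false, List.length_append, List.length_map, List.length_take, h]
      rw [hlen _ ((v.drop l).map (fun b _ => b))]
      simp [h]
  · intro u b
    by_cases hu : u.length < l
    · rw [hWlt u hu]
      by_cases hu' : (u ++ [b]).length < l
      · rw [hWlt _ hu']
      · have := hWge (u ++ [b]) [] (by simp at hu' ⊢; omega)
        rw [List.append_nil] at this
        rw [this]
        exact List.prefix_append _ _
    · obtain ⟨q, t, rfl, hq⟩ : ∃ q t, u = q ++ t ∧ q.length = l :=
        ⟨u.take l, u.drop l, (List.take_append_drop _ _).symm, by simp; omega⟩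
      rw [hWge q t hq, List.append_assoc, List.append_assoc, hWge q _ hq,
        List.prefix_append_right_inj]
      have := (h1 (t.map (fun b _ => b)) (fun _ => b)).map (ev q)
      simpa [ev, hq] using this
  · intro σ N hσ
    let t : List (D → Bool) := (List.range N).map (fun i q => (σ q.1).getD i false)
    rw [← h2 t]
    congr 1
    funext q
    by_cases hq : q.length = l
    · simp only [hq, if_true]
      rw [hWge q _ hq]
      congr 1
      apply h3
      simp only [t, List.map_map]
      apply List.ext_getElem
      · simp [hσ]
      · intro i hi hi'
        simp at hi
        simp [ev, hq, hi]
    · simp [hq]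

/-- one fusion step -/
theorem fusion_step {κ : Type} [Finite κ] (m l : ℕ) (χ : (List Bool → List Bool) → κ)
    (hχ : ∀ E E' : List Bool → List Bool, (∀ u, u.length < m + 1 → E u = E' u) → χ E = χ E')
    (W : List Bool → List Bool) :
    ∃ W' : List Bool → List Bool, SMap W' ∧ (∀ u, u.length < l → W' u = u) ∧
      ∀ E E' : List Bool → List Bool, SMap E → SMap E' →
        (∀ u, u.length < m → E u = E' u) → (∀ u, u.length < m → (E u).length < l) →
        (∀ u, u.length = m → (E u).take l = (E' u).take l) →
        (∀ u, u.length = m → l ≤ (E u).length) →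
        (∀ u v, u.length = m → v.length = m → (E u).take l = (E v).take l → u = v) →
        χ (W ∘ W' ∘ E) = χ (W ∘ W' ∘ E') := by
  classical
  have := finite_lists_lt m
  have := finite_lists_lt l
  have := finite_lists_eq m
  have := finite_lists_eq l
  let G := {u : List Bool // u.length < m} → {u : List Bool // u.length < l}
  let J := {u : List Bool // u.length = m} → {u : List Bool // u.length = l}
  let F : (List Bool → List Bool) → G → J → List Bool → List Bool := fun τ g j u =>
    if h : u.length < m then (g ⟨u, h⟩).1 else if h : u.length = m then τ (j ⟨u, h⟩).1 else []
  obtain ⟨W', hW', hfix, c0, hc0⟩ := halpern_lauchli (κ := G → J → κ) l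
    (fun τ g j => χ (W ∘ F τ g j))
  refine ⟨W', hW', hfix, ?_⟩
  have key : ∀ (E : List Bool → List Bool) (g : G) (j : J), SMap E →
      (∀ u, E u.1 = (g u).1) → (∀ u, (E u.1).take l = (j u).1) →
      (∀ u v, u.length = m → v.length = m → (E u).take l = (E v).take l → u = v) →
      χ (W ∘ W' ∘ E) = c0 g j := by
    intro E g j hE hg hj hinj
    let inv : List Bool → List Bool := fun q =>
      if h : ∃ u : List Bool, u.length = m ∧ (E u).take l = q then h.choose else List.replicate m false
    have hinv1 : ∀ q, (inv q).length = m := by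
      intro q
      by_cases h : ∃ u : List Bool, u.length = m ∧ (E u).take l = q
      · simp only [inv, h, dif_pos]; exact h.choose_spec.1
      · simp [inv, h]
    have hinv2 : ∀ u, u.length = m → inv ((E u).take l) = u := by
      intro u hu
      have h : ∃ u' : List Bool, u'.length = m ∧ (E u').take l = (E u).take l := ⟨u, hu, rfl⟩
      simp only [inv, h, dif_pos]
      exact hinj _ _ h.choose_spec.1 hu h.choose_spec.2
    rw [← hc0 (fun q => (E (inv q)).drop l) ((E (List.replicate m false)).length - l)
      (fun q => by rw [List.length_drop, hE.1 _ (List.replicate m false)]; simp [hinv1])]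
    apply hχ
    intro u hu
    simp only [Function.comp]
    congr 1
    by_cases h : u.length < m
    · simp only [F, h, dif_pos]
      rw [← hg ⟨u, h⟩]
      apply hfix
      rw [hg ⟨u, h⟩]
      exact (g _).2
    · have h' : u.length = m := by omega
      simp only [F, h, dif_neg, h', dif_pos, not_false_eq_true]
      rw [if_pos (j _).2, ← hj ⟨u, h'⟩]
      dsimp only
      rw [hinv2 u h', List.take_append_drop]
      simp
  intro E E' hE hE' hag hlt htk hge hinj
  rw [key E (fun u => ⟨E u.1, hlt _ u.2⟩)
      (fun u => ⟨(E u.1).take l, by rw [List.length_take]; exact min_eq_left (hge _ u.2)⟩) hE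
      (fun _ => rfl) (fun _ => rfl) hinj,
    key E' (fun u => ⟨E u.1, hlt _ u.2⟩)
      (fun u => ⟨(E u.1).take l, by rw [List.length_take]; exact min_eq_left (hge _ u.2)⟩) hE'
      (fun u => (hag _ u.2).symm) (fun u => (htk _ u.2).symm)
      (fun u v hu hv h => hinj u v hu hv (by rw [htk u hu, htk v hv, h]))]

theorem fusion {κ : Type} [Finite κ] (m : ℕ) (χ : (List Bool → List Bool) → κ)
    (hχ : ∀ E E' : List Bool → List Bool, (∀ u, u.length < m + 1 → E u = E' u) → χ E = χ E') :
    ∃ W : List Bool → List Bool, SMap W ∧ ∀ E E' : List Bool → List Bool, SMap E → SMap E' →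
        (∀ u, u.length < m → E u = E' u) → χ (W ∘ E) = χ (W ∘ E') := by
  choose st hst1 hst2 hst3 using fun (W : List Bool → List Bool) (l : ℕ) => fusion_step m l χ hχ W
  let A : ℕ → List Bool → List Bool := fun n =>
    Nat.rec (fun u => u) (fun n W => W ∘ st W n) n
  have A0 : A 0 = fun u => u := rfl
  have A1 : ∀ n, A (n + 1) = A n ∘ st (A n) n := fun _ => rfl
  clear_value A
  have hA : ∀ n, SMap (A n) := by
    intro n
    induction n with
    | zero => rw [A0]; exact SMap.id
    | succ n ih => rw [A1]; exact ih.comp (hst1 _ _)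
  have hR : ∀ n k, ∃ R, SMap R ∧ (∀ u, u.length < n → R u = u) ∧ A (n + k) = A n ∘ R := by
    intro n k
    induction k with
    | zero => exact ⟨fun u => u, SMap.id, fun _ _ => rfl, rfl⟩
    | succ k ih =>
      obtain ⟨R, h1, h2, h3⟩ := ih
      refine ⟨R ∘ st (A (n + k)) (n + k), h1.comp (hst1 _ _), ?_, ?_⟩
      · intro u hu
        rw [Function.comp, hst2 _ _ u (by omega), h2 u hu]
      · rw [← add_assoc, A1]
        conv_lhs => rw [h3]
        rw [h3]
        rfl
  have hst : ∀ n k u, u.length < n → A (n + k) u = A n u := by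
    intro n k u hu
    obtain ⟨R, _, h2, h3⟩ := hR n k
    rw [h3, Function.comp, h2 u hu]
  let W : List Bool → List Bool := fun u => A (u.length + 1) u
  have hW : ∀ n u, u.length < n → W u = A n u := by
    intro n u hu
    obtain ⟨k, rfl⟩ := Nat.exists_eq_add_of_le (Nat.succ_le_of_lt hu)
    exact (hst (u.length + 1) k u (by omega)).symm
  refine ⟨W, ⟨?_, ?_⟩, ?_⟩
  · intro u v h
    rw [hW (u.length + 1) u (by omega), hW (u.length + 1) v (by omega)]
    exact (hA _).1 u v h
  · intro u b
    rw [hW (u.length + 2) u (by omega), hW (u.length + 2) (u ++ [b]) (by simp)]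
    exact (hA _).2 u b
  · intro E E' hE hE' hag
    obtain ⟨l, hl1, hl2⟩ : ∃ l, (∀ u, u.length < m → (E u).length < l) ∧
        ∀ E1 E2 : List Bool → List Bool, SMap E1 → SMap E2 → (∀ u, u.length < m → E1 u = E u) →
          (∀ u, u.length < m → E2 u = E u) →
          (∀ u, u.length = m → (E1 u).take l = (E2 u).take l) ∧
          (∀ u, u.length = m → l ≤ (E1 u).length) ∧
          (∀ u v, u.length = m → v.length = m → (E1 u).take l = (E1 v).take l → u = v) := by
      cases m with
      | zero =>
        refine ⟨0, by simp, ?_⟩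
        intro E1 E2 _ _ _ _
        refine ⟨by simp, by simp, ?_⟩
        intro u v hu hv _
        rw [List.length_eq_zero_iff.1 hu, List.length_eq_zero_iff.1 hv]
      | succ m =>
        let l := (E (List.replicate m false)).length + 1
        have hl : ∀ u, u.length = m → (E u).length + 1 = l := by
          intro u hu
          simp only [l]
          rw [hE.1 u (List.replicate m false) (by simp [hu])]
        have hform : ∀ E1 : List Bool → List Bool, SMap E1 → (∀ u, u.length < m + 1 → E1 u = E u) →
            ∀ u b, u.length = m → (E1 (u ++ [b])).take l = E u ++ [b] ∧
              l ≤ (E1 (u ++ [b])).length := by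
          intro E1 h1 h2 u b hu
          have h3 := h1.2 u b
          rw [h2 u (by omega)] at h3
          have h4 : (E u ++ [b]).length = l := by simp [hl u hu]
          rw [← h4]
          exact ⟨(List.prefix_iff_eq_take.1 h3).symm, h3.length_le⟩
        have hsplit : ∀ u : List Bool, u.length = m + 1 → ∃ u' b, u = u' ++ [b] ∧ u'.length = m := by
          intro u hu
          induction u using List.reverseRecOn with
          | nil => simp at hu
          | append_singleton t b _ => exact ⟨t, b, rfl, by simpa using hu⟩
        refine ⟨l, ?_, ?_⟩
        · intro u hu
          rcases Nat.lt_succ_iff_lt_or_eq.1 hu with h | h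
          · have := hE.length_lt (u := u) (v := List.replicate m false) (by simpa using h)
            simp only [l]; omega
          · have := hl u h; omega
        · intro E1 E2 h1 h2 e1 e2
          refine ⟨?_, ?_, ?_⟩
          · intro u hu
            obtain ⟨u, b, rfl, hu'⟩ := hsplit u hu
            rw [(hform E1 h1 e1 u b hu').1, (hform E2 h2 e2 u b hu').1]
          · intro u hu
            obtain ⟨u, b, rfl, hu'⟩ := hsplit u hu
            exact (hform E1 h1 e1 u b hu').2
          · intro u v hu hv h
            obtain ⟨u, b, rfl, hu'⟩ := hsplit u hu
            obtain ⟨v, b', rfl, hv'⟩ := hsplit v hv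
            rw [(hform E1 h1 e1 u b hu').1, (hform E1 h1 e1 v b' hv').1] at h
            obtain ⟨h4, h5⟩ := List.append_inj' h rfl
            rw [hE.inj (hu'.trans hv'.symm) h4, h5]
    have red : ∀ E1 : List Bool → List Bool, SMap E1 → (∀ u, u.length < m → E1 u = E u) →
        ∃ R : List Bool → List Bool, SMap R ∧ (∀ u, u.length < m → R (E1 u) = E u) ∧
          χ (W ∘ E1) = χ (A l ∘ st (A l) l ∘ (R ∘ E1)) := by
      intro E1 h1 e1
      let N := (E1 (List.replicate m false)).length
      obtain ⟨R, r1, r2, r3⟩ := hR (l + 1) N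
      refine ⟨R, r1, ?_, ?_⟩
      · intro u hu
        rw [e1 u hu]
        exact r2 _ ((hl1 u hu).trans (Nat.lt_succ_self l))
      · have : χ (W ∘ E1) = χ (A (l + 1 + N) ∘ E1) := by
          apply hχ
          intro u hu
          simp only [Function.comp]
          apply hW
          have : (E1 u).length ≤ N := by
            rcases Nat.lt_succ_iff_lt_or_eq.1 hu with h | h
            · exact (h1.length_lt (u := u) (v := List.replicate m false) (by simpa using h)).le
            · exact (h1.1 u (List.replicate m false) (by simpa using h)).le
          omega
        rw [this, r3, A1]
        rfl
    obtain ⟨R, r1, r2, r3⟩ := red E hE (fun _ _ => rfl)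
    obtain ⟨R', r1', r2', r3'⟩ := red E' hE' (fun u hu => (hag u hu).symm)
    rw [r3, r3']
    obtain ⟨p1, p2, p3⟩ := hl2 (R ∘ E) (R' ∘ E') (r1.comp hE) (r1'.comp hE') r2 r2'
    apply hst3 _ _ _ _ (r1.comp hE) (r1'.comp hE')
    · intro u hu
      exact (r2 u hu).trans (r2' u hu).symm
    · intro u hu
      rw [Function.comp, r2 u hu]
      exact hl1 u hu
    · exact p1
    · exact p2
    · exact p3

theorem milliken (m : ℕ) : ∀ {κ : Type} [Finite κ] (χ : (List Bool → List Bool) → κ)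
    (_ : ∀ E E' : List Bool → List Bool, (∀ u, u.length < m → E u = E' u) → χ E = χ E'),
    ∃ W : List Bool → List Bool, SMap W ∧ ∃ c, ∀ E : List Bool → List Bool, SMap E →
      χ (W ∘ E) = c := by
  induction m with
  | zero =>
    intro κ _ χ hχ
    exact ⟨fun u => u, SMap.id, χ (fun u => u), fun E _ => hχ _ _ (by simp)⟩
  | succ m ih =>
    intro κ _ χ hχ
    obtain ⟨W, hW, h1⟩ := fusion m χ hχ
    let χ1 : (List Bool → List Bool) → Set κ := fun E =>
      {c | ∃ E' : List Bool → List Bool, SMap E' ∧ (∀ u, u.length < m → E' u = E u) ∧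
        c = χ (W ∘ E')}
    have hin : ∀ E, SMap E → χ (W ∘ E) ∈ χ1 E := fun E hE => ⟨E, hE, fun _ _ => rfl, rfl⟩
    obtain ⟨W2, hW2, c, hc⟩ := ih χ1 (by
      intro E E' h
      ext c
      constructor
      · rintro ⟨E1, a1, a2, a3⟩
        exact ⟨E1, a1, fun u hu => (a2 u hu).trans (h u hu), a3⟩
      · rintro ⟨E1, a1, a2, a3⟩
        exact ⟨E1, a1, fun u hu => (a2 u hu).trans (h u hu).symm, a3⟩)
    refine ⟨W ∘ W2, hW.comp hW2, χ (W ∘ W2), fun E hE => ?_⟩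
    have h2 := hin (W2 ∘ E) (hW2.comp hE)
    rw [hc E hE, ← hc (fun u => u) SMap.id] at h2
    obtain ⟨E', a1, a2, a3⟩ := h2
    have h3 : χ (W ∘ E') = χ (W ∘ W2) := h1 E' W2 a1 hW2 a2
    rw [← h3, ← a3]
    rfl

/-- envelopes -/
theorem envelope {A : Type} [Fintype A] : ∀ (M : ℕ) (f : A → List Bool),
    (∀ a, (f a).length ≤ M) → ∃ W : List Bool → List Bool, SMap W ∧ ∃ g : A → List Bool,
      (∀ a, (g a).length ≤ Fintype.card A + Fintype.card A * Fintype.card A) ∧ f = W ∘ g := by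
  classical
  intro M
  induction M with
  | zero =>
    intro f hf
    exact ⟨fun u => u, SMap.id, f, fun a => (hf a).trans (Nat.zero_le _), rfl⟩
  | succ M ih =>
    intro f hf
    by_cases hM : M + 1 ≤ Fintype.card A + Fintype.card A * Fintype.card A
    · exact ⟨fun u => u, SMap.id, f, fun a => (hf a).trans hM, rfl⟩
    let meet : A → A → ℕ := fun a b =>
      if h : ∃ i, (f a).take i = (f b).take i ∧ (f a)[i]? ≠ (f b)[i]? then Nat.find h else 0
    have hmeet : ∀ a b i, (f a).take i = (f b).take i → (f a)[i]? ≠ (f b)[i]? → meet a b = i := by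
      intro a b i h1 h2
      have h : ∃ i, (f a).take i = (f b).take i ∧ (f a)[i]? ≠ (f b)[i]? := ⟨i, h1, h2⟩
      simp only [meet, h, dif_pos]
      have hs := Nat.find_spec h
      apply le_antisymm (Nat.find_min' h ⟨h1, h2⟩)
      by_contra hlt
      push Not at hlt
      apply hs.2
      have := congrArg (fun l => l[Nat.find h]?) h1
      simpa [List.getElem?_take, hlt] using this
    let crit : A ⊕ A × A → ℕ := Sum.elim (fun a => (f a).length) (fun p => meet p.1 p.2)
    obtain ⟨i, hi, hcr⟩ : ∃ i ∈ Finset.range (M + 1), i ∉ Finset.univ.image crit := by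
      apply Finset.exists_mem_notMem_of_card_lt_card
      refine lt_of_le_of_lt Finset.card_image_le ?_
      simp
      omega
    have hiM : i < M + 1 := Finset.mem_range.1 hi
    have c1 : ∀ a, (f a).length ≠ i := fun a h => hcr (Finset.mem_image.2 ⟨Sum.inl a, by simp, h⟩)
    have c2 : ∀ a b, (f a).take i = (f b).take i → (f a)[i]? = (f b)[i]? := by
      intro a b h1
      by_contra h2
      exact hcr (Finset.mem_image.2 ⟨Sum.inr (a, b), by simp, hmeet a b i h1 h2⟩)
    let δ : List Bool → Bool := fun q =>
      if h : ∃ a, (f a).take i = q then ((f h.choose)[i]?).getD false else false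
    have hδ : ∀ a, δ ((f a).take i) = ((f a)[i]?).getD false := by
      intro a
      have h : ∃ b, (f b).take i = (f a).take i := ⟨a, rfl⟩
      simp only [δ, h, dif_pos]
      rw [c2 _ _ h.choose_spec]
    let D : List Bool → List Bool := fun u =>
      if u.length < i then u else u.take i ++ δ (u.take i) :: u.drop i
    have hD : SMap D := by
      constructor
      · intro u v h
        by_cases hu : u.length < i
        · simp [D, hu, h ▸ hu, h]
        · have hv : ¬ v.length < i := h ▸ hu
          simp [D, hu, hv, h]
      · intro u b
        by_cases hu : u.length < i
        · by_cases hu' : (u ++ [b]).length < i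
          · simp only [D, hu, hu', if_true]; exact List.prefix_rfl
          · simp only [D, hu, hu', if_true, if_false]
            have : (u ++ [b]).take i = u ++ [b] := List.take_of_length_le (by simp; omega)
            rw [this]
            exact List.prefix_append _ _
        · have hu' : ¬ (u ++ [b]).length < i := by simp; omega
          simp only [D, hu, hu', if_false]
          rw [List.take_append_of_le_length (by omega), List.drop_append_of_le_length (by omega)]
          simp
    let f' : A → List Bool := fun a => (f a).eraseIdx i
    have hf' : f = D ∘ f' := by
      funext a
      rcases lt_or_gt_of_ne (c1 a) with h | h
      · simp [D, f', h, List.eraseIdx_of_length_le h.le]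
      · have e1 : f' a = (f a).take i ++ (f a).drop (i + 1) := List.eraseIdx_eq_take_drop_succ _ _
        have hl : ((f a).take i).length = i := by simp; omega
        have hn : ¬ (f' a).length < i := by rw [e1]; simp; omega
        simp only [Function.comp, D, hn, if_false]
        rw [e1, List.take_append_of_le_length hl.ge, List.take_take, min_self, hδ,
          List.drop_append_of_le_length hl.ge]
        simp [h]
    obtain ⟨W, hW, g, hg, hfg⟩ := ih f' (by
      intro a
      rcases lt_or_gt_of_ne (c1 a) with h | h
      · simp only [f', List.eraseIdx_of_length_le h.le]; omega
      · have := hf a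
        simp only [f', List.length_eraseIdx, h, if_true]; omega)
    exact ⟨D ∘ W, hD.comp hW, g, hg, by rw [hf', hfg]; rfl⟩
end Tree

/-! The two orders on binary words -/
section Orders

def nv (u : List Bool) : ℕ := u.foldl (fun n b => 2 * n + b.toNat) 1

theorem nv_snoc (u : List Bool) (b : Bool) : nv (u ++ [b]) = 2 * nv u + b.toNat := by
  simp [nv]

theorem nv_pos (u : List Bool) : 1 ≤ nv u := by
  induction u using List.reverseRecOn with
  | nil => simp [nv]
  | append_singleton t b ih => rw [nv_snoc]; omega

theorem nv_bounds (u : List Bool) : 2 ^ u.length ≤ nv u ∧ nv u < 2 ^ (u.length + 1) := by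
  induction u using List.reverseRecOn with
  | nil => simp [nv]
  | append_singleton t b ih =>
    rw [nv_snoc, List.length_append]
    have := b.toNat_lt
    simp only [List.length_singleton]
    rw [pow_succ, pow_succ] at *
    omega

theorem nv_lt_of_length {u v : List Bool} (h : u.length < v.length) : nv u < nv v :=
  (nv_bounds u).2.trans_le ((Nat.pow_le_pow_right (by norm_num) h).trans (nv_bounds v).1)

theorem nv_inj : Function.Injective nv := by
  intro u
  induction u using List.reverseRecOn with
  | nil =>
    intro v h
    by_contra hne
    have : 0 < v.length := List.length_pos_iff.2 (Ne.symm hne)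
    have := nv_lt_of_length (u := []) (v := v) this
    omega
  | append_singleton t b ih =>
    intro v
    induction v using List.reverseRecOn with
    | nil =>
      intro h
      have := nv_lt_of_length (u := []) (v := t ++ [b]) (by simp)
      omega
    | append_singleton s c _ =>
      intro h
      rw [nv_snoc, nv_snoc] at h
      have h1 := b.toNat_lt
      have h2 := c.toNat_lt
      have h3 : nv t = nv s := by omega
      have h4 : b.toNat = c.toNat := by omega
      have h5 : b = c := by cases b <;> cases c <;> simp at h4 ⊢
      rw [ih h3, h5]

theorem nv_surj : ∀ n, ∃ u, nv u = n + 1 := by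
  intro n
  induction n using Nat.strong_induction_on with
  | _ n ih =>
    rcases Nat.eq_zero_or_pos n with rfl | hn
    · exact ⟨[], rfl⟩
    · obtain ⟨u, hu⟩ := ih ((n + 1) / 2 - 1) (by omega)
      rcases Nat.mod_two_eq_zero_or_one (n + 1) with h | h
      · exact ⟨u ++ [false], by rw [nv_snoc, hu]; simp; omega⟩
      · exact ⟨u ++ [true], by rw [nv_snoc, hu]; simp; omega⟩

theorem nv_append {p q : List Bool} (h : nv p < nv q) : ∀ {r r' : List Bool},
    r.length = r'.length → nv (p ++ r) < nv (q ++ r') := by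
  intro r
  induction r using List.reverseRecOn with
  | nil =>
    intro r' hl
    have : r' = [] := List.length_eq_zero_iff.1 hl.symm
    simpa [this] using h
  | append_singleton t b ih =>
    intro r' hl
    induction r' using List.reverseRecOn with
    | nil => simp at hl
    | append_singleton s c _ =>
      have := ih (r' := s) (by simpa using hl)
      rw [← List.append_assoc, ← List.append_assoc, nv_snoc, nv_snoc]
      have h1 := b.toNat_lt
      omega

theorem nv_prefix {p q u v : List Bool} (h : nv p < nv q) (hp : p <+: u) (hq : q <+: v)
    (hpq : p.length = q.length) (huv : u.length = v.length) : nv u < nv v := by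
  obtain ⟨r, rfl⟩ := hp
  obtain ⟨r', rfl⟩ := hq
  exact nv_append h (by simp at huv; omega)

theorem nv_map {W : List Bool → List Bool} (hW : SMap W) : ∀ {u v : List Bool}, nv u < nv v →
    nv (W u) < nv (W v) := by
  have same : ∀ u v : List Bool, u.length = v.length → nv u < nv v → nv (W u) < nv (W v) := by
    intro u
    induction u using List.reverseRecOn with
    | nil =>
      intro v hl h
      have : v = [] := List.length_eq_zero_iff.1 hl.symm
      simp [this] at h
    | append_singleton t b ih =>
      intro v hl h
      induction v using List.reverseRecOn with
      | nil => simp at hl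
      | append_singleton s c _ =>
        have hl' : t.length = s.length := by simpa using hl
        have h1 := b.toNat_lt
        have h2 := c.toNat_lt
        have hl'' := hW.1 _ _ hl'
        refine nv_prefix ?_ (hW.2 t b) (hW.2 s c) (by simp [hl'']) (hW.1 _ _ hl)
        rw [nv_snoc, nv_snoc] at h ⊢
        rcases lt_trichotomy (nv t) (nv s) with h3 | h3 | h3
        · have := ih s hl' h3
          omega
        · have h4 : t = s := nv_inj h3
          subst h4
          omega
        · omega
  intro u v h
  rcases lt_trichotomy u.length v.length with h1 | h1 | h1
  · exact nv_lt_of_length (hW.length_lt h1)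
  · exact same u v h1 h
  · have := nv_lt_of_length h1
    omega

def dv : List Bool → ℚ
  | [] => 1 / 2
  | false :: u => dv u / 2
  | true :: u => (1 + dv u) / 2

theorem dv_bounds (u : List Bool) : 0 < dv u ∧ dv u < 1 := by
  induction u with
  | nil => norm_num [dv]
  | cons b u ih => cases b <;> simp only [dv] <;> constructor <;> linarith [ih.1, ih.2]

theorem dv_left {p u : List Bool} (h : p ++ [false] <+: u) : dv u < dv p := by
  obtain ⟨t, rfl⟩ := h
  induction p with
  | nil => simp [dv]; linarith [(dv_bounds t).2]
  | cons b p ih => cases b <;> simp only [dv, List.cons_append] <;> linarith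

theorem dv_right {p u : List Bool} (h : p ++ [true] <+: u) : dv p < dv u := by
  obtain ⟨t, rfl⟩ := h
  induction p with
  | nil => simp [dv]; linarith [(dv_bounds t).1]
  | cons b p ih => cases b <;> simp only [dv, List.cons_append] <;> linarith

/-- `p` separates `u` from `v` in the in-order. -/
def InSep (u v : List Bool) : Prop := ∃ p, (u = p ∨ p ++ [false] <+: u) ∧
  (v = p ∨ p ++ [true] <+: v) ∧ u ≠ v

theorem InSep.cons {u v : List Bool} (b : Bool) (h : InSep u v) : InSep (b :: u) (b :: v) := by
  obtain ⟨p, h1, h2, h3⟩ := h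
  exact ⟨b :: p, by simpa using h1, by simpa using h2, by simpa using h3⟩

theorem sep_total : ∀ u v : List Bool, u ≠ v → InSep u v ∨ InSep v u := by
  intro u
  induction u with
  | nil =>
    intro v h
    cases v with
    | nil => exact absurd rfl h
    | cons b v =>
      cases b
      · exact Or.inr ⟨[], by simp, by simp, by simp⟩
      · exact Or.inl ⟨[], by simp, by simp, by simp⟩
  | cons a u ih =>
    intro v h
    cases v with
    | nil =>
      cases a
      · exact Or.inl ⟨[], by simp, by simp, by simp⟩
      · exact Or.inr ⟨[], by simp, by simp, by simp⟩
    | cons b v =>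
      by_cases hab : a = b
      · subst hab
        exact (ih v (by simpa using h)).imp (InSep.cons a) (InSep.cons a)
      · cases a <;> cases b
        · exact absurd rfl hab
        · exact Or.inl ⟨[], by simp, by simp, by simp⟩
        · exact Or.inr ⟨[], by simp, by simp, by simp⟩
        · exact absurd rfl hab

theorem InSep.lt {u v : List Bool} (h : InSep u v) : dv u < dv v := by
  obtain ⟨p, h1, h2, h3⟩ := h
  rcases h1 with rfl | h1 <;> rcases h2 with rfl | h2
  · exact absurd rfl h3
  · exact dv_right h2
  · exact dv_left h1
  · exact (dv_left h1).trans (dv_right h2)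

theorem dv_inj : Function.Injective dv := by
  intro u v h
  by_contra hne
  rcases sep_total u v hne with h1 | h1
  · exact h1.lt.ne h
  · exact h1.lt.ne h.symm

theorem dv_map {W : List Bool → List Bool} (hW : SMap W) {u v : List Bool} (h : dv u < dv v) :
    dv (W u) < dv (W v) := by
  have hne : u ≠ v := by rintro rfl; exact lt_irrefl _ h
  have hs : InSep u v := (sep_total u v hne).resolve_right fun h' => lt_asymm h h'.lt
  obtain ⟨p, h1, h2, -⟩ := hs
  rcases h1 with rfl | h1 <;> rcases h2 with rfl | h2
  · exact absurd rfl hne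
  · exact dv_right (hW.ext h2)
  · exact dv_left (hW.ext h1)
  · exact (dv_left (hW.ext h1)).trans (dv_right (hW.ext h2))

theorem dv_range : ∀ (n m : ℕ) (β γ : ℕ → Bool), (∀ i, β i = true → γ i = true) → n ≠ m →
    (n < m → γ n = true) → (m < n → β m = false) →
    dv ((List.range n).map β) < dv ((List.range m).map γ) := by
  intro n
  induction n with
  | zero =>
    intro m β γ _ hnm h1 _
    obtain ⟨m, rfl⟩ : ∃ k, m = k + 1 := ⟨m - 1, by omega⟩
    rw [List.range_succ_eq_map]
    simp only [List.map_cons, h1 (by omega), List.range_zero, List.map_nil, dv]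
    linarith [(dv_bounds ((List.range m).map Nat.succ |>.map γ)).1]
  | succ n ih =>
    intro m β γ h hnm h1 h2
    cases m with
    | zero =>
      rw [List.range_succ_eq_map]
      simp only [List.map_cons, h2 (by omega), List.range_zero, List.map_nil, dv]
      linarith [(dv_bounds ((List.range n).map Nat.succ |>.map β)).2]
    | succ m =>
      have := ih m (β ∘ Nat.succ) (γ ∘ Nat.succ) (fun i => h _) (by omega)
        (fun hh => h1 (by omega)) (fun hh => h2 (by omega))
      rw [List.range_succ_eq_map, List.range_succ_eq_map]
      simp only [List.map_cons, List.map_map]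
      have h0 := h 0
      have b1 := dv_bounds ((List.range n).map (β ∘ Nat.succ))
      have b2 := dv_bounds ((List.range m).map (γ ∘ Nat.succ))
      cases hb : β 0 <;> cases hc : γ 0
      · simp only [dv]; linarith
      · simp only [dv]; linarith [b1.2, b2.1]
      · simp [hb, hc] at h0
      · simp only [dv]; linarith

def pQ (u v : List Bool) : Prop := nv u ≤ nv v ∧ dv u ≤ dv v
def lQ (u v : List Bool) : Prop := nv u < nv v

theorem smap_emb {W : List Bool → List Bool} (hW : SMap W) : LOPEmb pQ lQ pQ lQ W := by
  have hn : ∀ u v, nv u < nv v ↔ nv (W u) < nv (W v) := by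
    intro u v
    refine ⟨nv_map hW, fun h => ?_⟩
    by_contra h'
    rcases (not_lt.1 h').lt_or_eq with h2 | h2
    · exact lt_asymm h (nv_map hW h2)
    · rw [nv_inj h2] at h; exact lt_irrefl _ h
  have hd : ∀ u v, dv u < dv v ↔ dv (W u) < dv (W v) := by
    intro u v
    refine ⟨dv_map hW, fun h => ?_⟩
    by_contra h'
    rcases (not_lt.1 h').lt_or_eq with h2 | h2
    · exact lt_asymm h (dv_map hW h2)
    · rw [dv_inj h2] at h; exact lt_irrefl _ h
  refine ⟨?_, ?_, hn⟩
  · intro u v h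
    by_contra hne
    rcases lt_or_gt_of_ne (fun h' => hne (nv_inj h')) with h1 | h1
    · have := (hn _ _).1 h1; rw [h] at this; exact lt_irrefl _ this
    · have := (hn _ _).1 h1; rw [h] at this; exact lt_irrefl _ this
  · intro u v
    simp only [pQ, ← not_lt, hn v u, hd v u]

theorem memK_Q : MemK pQ lQ := by
  refine ⟨⟨?_, ?_, ?_⟩, Or.inr ?_, ?_⟩
  · exact { refl := fun u => ⟨le_rfl, le_rfl⟩
            trans := fun u v w h1 h2 => ⟨h1.1.trans h2.1, h1.2.trans h2.2⟩
            antisymm := fun u v h1 h2 => nv_inj (le_antisymm h1.1 h2.1) }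
  · exact { irrefl := fun u => lt_irrefl (nv u)
            trans := fun u v w h1 h2 => lt_trans (a := nv u) h1 h2
            trichotomous := fun u v h1 h2 => nv_inj (le_antisymm (not_lt.1 h2) (not_lt.1 h1)) }
  · intro u v h hne
    exact lt_of_le_of_ne h.1 fun h' => hne (nv_inj h')
  · refine ⟨Equiv.ofBijective (fun u => nv u - 1) ⟨?_, ?_⟩, ?_⟩
    · intro u v h
      have h1 := nv_pos u
      have h2 := nv_pos v
      apply nv_inj
      simp only at h
      omega
    · intro n
      obtain ⟨u, hu⟩ := nv_surj n
      exact ⟨u, by simp [hu]⟩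
    · intro u v
      have h1 := nv_pos u
      have h2 := nv_pos v
      change nv u < nv v ↔ nv u - 1 < nv v - 1
      omega
  · rintro ⟨f, -, hp, hl⟩
    have l01 : nv (f 0) < nv (f 1) := (hl 0 1).1 (by simp [lIStar])
    have l12 : nv (f 1) < nv (f 2) := (hl 1 2).1 (by simp [lIStar])
    have p02 : pQ (f 0) (f 2) := (hp 0 2).1 (by simp [pIStar])
    have p01 : ¬ pQ (f 0) (f 1) := fun h => by have := (hp 0 1).2 h; simp [pIStar] at this
    have p12 : ¬ pQ (f 1) (f 2) := fun h => by have := (hp 1 2).2 h; simp [pIStar] at this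
    have d1 : dv (f 1) < dv (f 0) := by
      by_contra h; exact p01 ⟨l01.le, not_lt.1 h⟩
    have d2 : dv (f 2) < dv (f 1) := by
      by_contra h; exact p12 ⟨l12.le, not_lt.1 h⟩
    exact absurd p02.2 (not_le.2 (d2.trans d1))

theorem universal {A : Type} {pa la : A → A → Prop} (hA : MemK pa la) :
    ∃ f : A → List Bool, LOPEmb pa la pQ lQ f := by
  classical
  obtain ⟨⟨hpo, hlo, hext⟩, hfin, hI⟩ := hA
  have irr : ∀ x, ¬ la x x := hlo.irrefl
  have ltr : ∀ x y z, la x y → la y z → la x z := hlo.trans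
  have tot : ∀ x y, x ≠ y → la x y ∨ la y x := by
    intro x y hne
    by_contra h
    push Not at h
    exact hne (hlo.trichotomous x y h.1 h.2)
  have prefl : ∀ x, pa x x := hpo.refl
  have ptr : ∀ x y z, pa x y → pa y z → pa x z := hpo.trans
  have asym : ∀ x y, la x y → ¬ la y x := fun x y h h' => irr x (ltr _ _ _ h h')
  have pl : ∀ x y, la x y → ¬ pa y x := fun x y h h' =>
    asym x y h (hext y x h' (by rintro rfl; exact irr _ h))
  obtain ⟨e, he⟩ : ∃ e : A → ℕ, ∀ x y, la x y ↔ e x < e y := by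
    rcases hfin with hf | ⟨e, he⟩
    · have := Fintype.ofFinite A
      have mono : ∀ x y, la x y → (Finset.univ.filter fun z => la z x).card <
          (Finset.univ.filter fun z => la z y).card := by
        intro x y h
        apply Finset.card_lt_card
        rw [Finset.ssubset_iff_of_subset]
        · exact ⟨x, by simp [h], by simp [irr]⟩
        · intro z; simp only [Finset.mem_filter, Finset.mem_univ, true_and]
          exact fun h' => ltr _ _ _ h' h
      refine ⟨fun x => (Finset.univ.filter fun z => la z x).card, fun x y => ⟨mono x y, fun h => ?_⟩⟩
      by_contra h'
      by_cases hxy : x = y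
      · subst hxy; exact lt_irrefl _ h
      · exact lt_asymm h (mono y x ((tot x y hxy).resolve_left h'))
    · exact ⟨e, he⟩
  have einj : ∀ x y, e x = e y → x = y := by
    intro x y h
    by_contra hne
    rcases tot x y hne with h1 | h1
    · have := (he _ _).1 h1; omega
    · have := (he _ _).1 h1; omega
  have hI' : ∀ x y z, la x y → la y z → ¬ pa x y → ¬ pa y z → ¬ pa x z := by
    intro x y z h1 h2 h3 h4 h5
    apply hI
    have h6 := ltr _ _ _ h1 h2
    have n1 : x ≠ y := by rintro rfl; exact irr _ h1
    have n2 : y ≠ z := by rintro rfl; exact irr _ h2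
    have n3 : x ≠ z := by rintro rfl; exact irr _ h6
    refine ⟨![x, y, z], ?_, ?_, ?_⟩
    · intro i j h
      fin_cases i <;> fin_cases j <;> simp_all
    · intro i j
      fin_cases i <;> fin_cases j <;>
        simp [pIStar, prefl, h3, h4, h5, pl _ _ h1, pl _ _ h2, pl _ _ h6]
    · intro i j
      fin_cases i <;> fin_cases j <;>
        simp [lIStar, irr, h1, h2, h6, asym _ _ h1, asym _ _ h2, asym _ _ h6]
  let l2 : A → A → Prop := fun x y => (la x y ∧ pa x y) ∨ (la y x ∧ ¬ pa y x)
  have l2tot : ∀ x y, x ≠ y → l2 x y ∨ l2 y x := by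
    intro x y hne
    rcases tot x y hne with h | h
    · by_cases hp : pa x y
      · exact Or.inl (Or.inl ⟨h, hp⟩)
      · exact Or.inr (Or.inr ⟨h, hp⟩)
    · by_cases hp : pa y x
      · exact Or.inr (Or.inl ⟨h, hp⟩)
      · exact Or.inl (Or.inr ⟨h, hp⟩)
  have l2asym : ∀ x y, l2 x y → ¬ l2 y x := by
    rintro x y (⟨h1, h2⟩ | ⟨h1, h2⟩) (⟨h3, h4⟩ | ⟨h3, h4⟩)
    · exact asym _ _ h1 h3
    · exact h4 h2
    · exact h2 h4
    · exact asym _ _ h1 h3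
  have l2tr : ∀ x y z, l2 x y → l2 y z → l2 x z := by
    rintro x y z (⟨h1, h2⟩ | ⟨h1, h2⟩) (⟨h3, h4⟩ | ⟨h3, h4⟩)
    · exact Or.inl ⟨ltr _ _ _ h1 h3, ptr _ _ _ h2 h4⟩
    ·
      by_cases hxz : x = z
      · subst hxz; exact absurd h2 h4
      rcases tot x z hxz with h | h
      · by_cases hp : pa x z
        · exact Or.inl ⟨h, hp⟩
        · exact absurd h2 (hI' x z y h h3 hp h4)
      · refine Or.inr ⟨h, fun hp => h4 (ptr _ _ _ hp h2)⟩
    ·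
      by_cases hxz : x = z
      · subst hxz; exact absurd h4 h2
      rcases tot x z hxz with h | h
      · by_cases hp : pa x z
        · exact Or.inl ⟨h, hp⟩
        · exact absurd h4 (hI' y x z h1 h h2 hp)
      · exact Or.inr ⟨h, fun hp => h2 (ptr _ _ _ h4 hp)⟩
    · exact Or.inr ⟨ltr _ _ _ h3 h1, hI' _ _ _ h3 h1 h4 h2⟩
  let β : A → ℕ → Bool := fun x i => decide (∃ z, e z = i ∧ l2 z x)
  let f : A → List Bool := fun x => (List.range (e x)).map (β x)
  have fn : ∀ x y, la x y → nv (f x) < nv (f y) := by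
    intro x y h
    apply nv_lt_of_length
    simpa [f] using (he x y).1 h
  have fd : ∀ x y, l2 x y → dv (f x) < dv (f y) := by
    intro x y h
    have hne : x ≠ y := by rintro rfl; exact l2asym _ _ h h
    apply dv_range
    · intro i hi
      simp only [β, decide_eq_true_eq] at hi ⊢
      obtain ⟨z, h1, h2⟩ := hi
      exact ⟨z, h1, l2tr _ _ _ h2 h⟩
    · exact fun h' => hne (einj _ _ h')
    · intro _
      simp only [β, decide_eq_true_eq]
      exact ⟨x, rfl, h⟩
    · intro _
      simp only [β, decide_eq_false_iff_not]
      rintro ⟨z, h1, h2⟩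
      rw [einj _ _ h1] at h2
      exact l2asym _ _ h h2
  refine ⟨f, ?_, ?_, ?_⟩
  · intro x y h
    by_contra hne
    rcases tot x y hne with h1 | h1
    · have := fn _ _ h1; rw [h] at this; exact lt_irrefl _ this
    · have := fn _ _ h1; rw [h] at this; exact lt_irrefl _ this
  · intro x y
    constructor
    · intro h
      by_cases hxy : x = y
      · subst hxy; exact ⟨le_rfl, le_rfl⟩
      · have := hext x y h hxy
        exact ⟨(fn _ _ this).le, (fd _ _ (Or.inl ⟨this, h⟩)).le⟩
    · rintro ⟨h1, h2⟩
      by_contra hp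
      have hxy : x ≠ y := by rintro rfl; exact hp (prefl _)
      rcases tot x y hxy with h | h
      · exact absurd h2 (not_le.2 (fd y x (Or.inr ⟨h, hp⟩)))
      · exact absurd h1 (not_le.2 (fn y x h))
  · intro x y
    refine ⟨fn x y, fun h => ?_⟩
    by_contra h'
    by_cases hxy : x = y
    · subst hxy; exact lt_irrefl _ h
    · exact lt_asymm h (fn y x ((tot x y hxy).resolve_left h'))

theorem big_ramsey (A : Type) [Fintype A] : ∃ T : ℕ, 0 < T ∧ ∀ k, 2 ≤ k →
    ∀ χ : (A → List Bool) → Fin k, ∃ W, SMap W ∧ ∃ S : Set (Fin k), S.ncard ≤ T ∧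
      ∀ f : A → List Bool, χ (W ∘ f) ∈ S := by
  let m := Fintype.card A + Fintype.card A * Fintype.card A
  have := finite_lists_lt (m + 1)
  let G := A → {u : List Bool // u.length < m + 1}
  have : Nonempty G := ⟨fun _ => ⟨[], by simp⟩⟩
  refine ⟨Nat.card G, Nat.card_pos, ?_⟩
  intro k hk χ
  obtain ⟨W, hW, c, hc⟩ := milliken (m + 1) (κ := G → Fin k)
    (fun E g => χ (fun a => E (g a).1)) (by
      intro E E' h
      funext g
      congr 1
      funext a
      exact h _ (g a).2)
  refine ⟨W, hW, Set.range c, ?_, ?_⟩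
  · rw [← Set.image_univ, ← Set.ncard_univ]
    exact Set.ncard_image_le Set.finite_univ
  · intro f
    obtain ⟨E, hE, g, hg, rfl⟩ := envelope (Finset.univ.sup fun a => (f a).length) f
      (fun a => Finset.le_sup (f := fun a => (f a).length) (Finset.mem_univ a))
    exact ⟨fun a => ⟨g a, Nat.lt_succ_of_le (hg a)⟩, by rw [← hc E hE]; rfl⟩

end Orders

theorem stmt12 :
    ∃ (Q : Type) (pq lq : Q → Q → Prop),
      Countable Q ∧ Infinite Q ∧ MemK pq lq ∧
      (∀ (A : Type) (pa la : A → A → Prop), MemK pa la →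
        ∃ f : A → Q, LOPEmb pa la pq lq f) ∧
      (∀ (A : Type) (pa la : A → A → Prop), Finite A → MemK pa la →
        ∃ T : ℕ, 0 < T ∧ ∀ k, 2 ≤ k →
          ∀ χ : {f : A → Q // LOPEmb pa la pq lq f} → Fin k,
            ∃ w : {g : Q → Q // LOPEmb pq lq pq lq g},
              (χ '' {p | ∃ f₀ : {f : A → Q // LOPEmb pa la pq lq f},
                p.val = w.val ∘ f₀.val}).ncard ≤ T) := by
  refine ⟨List Bool, pQ, lQ, inferInstance, inferInstance, memK_Q, ?_, ?_⟩
  · intro A pa la hA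
    exact universal hA
  · intro A pa la hfin hA
    classical
    have := Fintype.ofFinite A
    obtain ⟨T, hT, h⟩ := big_ramsey A
    refine ⟨T, hT, fun k hk χ => ?_⟩
    obtain ⟨W, hW, S, hS, hf⟩ := h k hk
      (fun f => if hf : LOPEmb pa la pQ lQ f then χ ⟨f, hf⟩ else ⟨0, by omega⟩)
    refine ⟨⟨W, smap_emb hW⟩, le_trans (Set.ncard_le_ncard ?_ (Set.toFinite S)) hS⟩
    rintro _ ⟨p, ⟨f₀, hp⟩, rfl⟩
    have h1 := hf f₀.1
    have h2 : W ∘ f₀.1 = p.1 := hp.symm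
    rw [h2, dif_pos p.2] at h1
    exact h1
end

section
/- Let S = {0 = s₀ < s₁ < … < s_n} be a compact distance set with exactly one nontrivial block (i.e., S∖{0} is a single block). Let U be a countably infinite S-metric space that is universal for finite S-metric spaces (every finite S-metric space embeds isometrically into U) and ultrahomogeneous (every isometry between finite subspaces of U extends to a surjective self-isometry of U). Then every finite S-metric space M has finite big Ramsey degree in U: there exists a positive integer T such that for every k ≥ 2 and every coloring χ of the set of isometric embeddings of M into U with k colors, there is an isometric embedding w of U into itself such that {χ(w ∘ f) : f an isometric embedding of M into U} has at most T elements. -/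
/-- `s` is a jump number of the finite set `S = {0 = s₀ < s₁ < … < s_n}`. -/
def JumpNumber (S : Finset ℝ) (s : ℝ) : Prop :=
  s ∈ S ∧ ∀ t ∈ S, s < t → 2 * s < t

/-- `x ≈ y`: `x` and `y` lie in the same block of `S`. -/
def SameBlock (S : Finset ℝ) (x y : ℝ) : Prop :=
  x ∈ S ∧ y ∈ S ∧
    ((x = 0 ∧ y = 0) ∨
      (x ≠ 0 ∧ y ≠ 0 ∧ ∀ j, JumpNumber S j → ¬ (min x y ≤ j ∧ j < max x y)))

/-- `S` is a compact distance set: for nonzero `x, y ∈ S`,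
`|x − y| ≤ s₁` iff `x ≈ y`. -/
def CompactDistanceSet (S : Finset ℝ) (s1 : ℝ) : Prop :=
  ∀ x ∈ S, ∀ y ∈ S, x ≠ 0 → y ≠ 0 → (|x - y| ≤ s1 ↔ SameBlock S x y)

section UF
attribute [local instance] Ultrafilter.mul Ultrafilter.semigroup
open Filter

theorem exists_min_idem {G : Type*} [Nonempty G] [Semigroup G] [TopologicalSpace G] [CompactSpace G]
    [T2Space G] (hc : ∀ r : G, Continuous (· * r)) :
    ∃ p : G, p * p = p ∧ ∀ x : G, ∃ y : G, y * x * p = p := by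
  let S : Set (Set G) := { N | IsClosed N ∧ N.Nonempty ∧ ∀ (g : G), ∀ m ∈ N, g * m ∈ N }
  obtain ⟨N, hN⟩ : ∃ N', Minimal (· ∈ S) N' := by
    refine zorn_superset _ fun c hcs hch => ?_
    refine ⟨⋂₀ c, ⟨isClosed_sInter fun t ht => (hcs ht).1, ?_, fun g m hm => ?_⟩, fun s hs =>
      Set.sInter_subset_of_mem hs⟩
    · obtain rfl | hcnemp := c.eq_empty_or_nonempty
      · rw [Set.sInter_empty]
        apply Set.univ_nonempty
      rw [Set.sInter_eq_iInter]
      have := hcnemp.coe_sort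
      apply IsCompact.nonempty_iInter_of_directed_nonempty_isCompact_isClosed ((↑) : c → Set G)
      · exact DirectedOn.directed_val (IsChain.directedOn hch.symm)
      exacts [fun i => (hcs i.prop).2.1, fun i => (hcs i.prop).1.isCompact, fun i => (hcs i.prop).1]
    · rw [Set.mem_sInter]
      exact fun t ht => (hcs ht).2.2 g m (Set.mem_sInter.mp hm t ht)
  obtain ⟨hcl, hne, hid⟩ := hN.prop
  obtain ⟨p, hp, hpp⟩ := exists_idempotent_in_compact_subsemigroup hc N hne hcl.isCompact
    (fun x _ y hy => hid x y hy)
  refine ⟨p, hpp, fun x => ?_⟩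
  have hS : Set.range (· * (x * p)) ∈ S := by
    refine ⟨(isCompact_range (hc _)).isClosed, Set.range_nonempty _, ?_⟩
    rintro g _ ⟨y, rfl⟩
    exact ⟨g * y, mul_assoc _ _ _⟩
  have hsub : Set.range (· * (x * p)) ⊆ N := by
    rintro _ ⟨y, rfl⟩
    exact hid _ _ (hid _ _ hp)
  have heq := hN.eq_of_subset hS hsub
  rw [← heq] at hp
  obtain ⟨y, hy⟩ := hp
  exact ⟨y, by rw [mul_assoc]; exact hy⟩

theorem min_idem_right {G : Type*} [Semigroup G] {p : G} 
    (h : ∀ x : G, ∃ y : G, y * x * p = p) {f : G} (hf : f * f = f) (hfp : f * p = f) :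
    p * f = p := by
  obtain ⟨y, hy⟩ := h f
  rw [mul_assoc, hfp] at hy
  rw [← hy, mul_assoc, hf]

theorem min_idem_swap {G : Type*} [Semigroup G] {p : G} (hp : p * p = p)
    (h : ∀ x : G, ∃ y : G, y * x * p = p) {j a : G} (hj : p * j * p * a * p = p) :
    p * a * p * j * p = p := by
  obtain ⟨t, ht⟩ := h (p * j * p)
  have hx : p * t * p * (p * j * p) = p := by
    have : p * t * p * (p * j * p) = p * (t * (p * j * p) * p) := by
      simp only [← mul_assoc]
      simp only [mul_assoc, hp]
    rw [this, ht, hp]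
  have hyx : (p * j * p) * (p * a * p) = p := by
    calc (p * j * p) * (p * a * p) = p * j * (p * p) * a * p := by simp only [mul_assoc]
      _ = p := by rw [hp, hj]
  have hz : p * t * p = p * a * p := by
    calc p * t * p = p * t * (p * p) := by rw [hp]
      _ = p * t * p * p := by simp only [mul_assoc]
      _ = p * t * p * ((p * j * p) * (p * a * p)) := by rw [hyx]
      _ = (p * t * p * (p * j * p)) * (p * a * p) := by simp only [mul_assoc]
      _ = p * (p * a * p) := by rw [hx]
      _ = (p * p) * a * p := by simp only [mul_assoc]
      _ = p * a * p := by rw [hp]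
  have : p * a * p * j * p = (p * a * p) * (p * j * p) := by
    calc p * a * p * j * p = p * a * (p * p) * j * p := by rw [hp]
      _ = _ := by simp only [mul_assoc]
  rw [this, ← hz, hx]

theorem uf_map_mul {M N : Type*} [Semigroup M] [Semigroup N] (φ : M →ₙ* N) (U V : Ultrafilter M) :
    (U * V).map φ = U.map φ * V.map φ := by
  apply Ultrafilter.coe_inj.mp
  apply Filter.ext'
  intro P
  simp [Ultrafilter.eventually_mul, Filter.eventually_map]

theorem hj_uf (A : Type*) : ∃ (p : Ultrafilter (FreeMonoid A))
    (q : Ultrafilter (FreeMonoid (Option A))), p * p = p ∧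
    ∀ a : A, p * pure (FreeMonoid.of a) * q.map (FreeMonoid.map (fun o : Option A => o.getD a)) = p := by
  obtain ⟨p, hp, hmin⟩ := exists_min_idem (G := Ultrafilter (FreeMonoid A))
    Ultrafilter.continuous_mul_left
  let ι : FreeMonoid A →ₙ* FreeMonoid (Option A) := ((FreeMonoid.map some : FreeMonoid A →* FreeMonoid (Option A)) : FreeMonoid A →ₙ* FreeMonoid (Option A))
  let φ : A → FreeMonoid (Option A) →ₙ* FreeMonoid A := fun a =>
    ((FreeMonoid.map (fun o : Option A => o.getD a) : FreeMonoid (Option A) →* FreeMonoid A) : FreeMonoid (Option A) →ₙ* FreeMonoid A)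
  let P : Ultrafilter (FreeMonoid (Option A)) := p.map ι
  let X : Ultrafilter (FreeMonoid (Option A)) := pure (FreeMonoid.of none)
  have hφP : ∀ a, P.map (φ a) = p := by
    intro a
    show (p.map ι).map (φ a) = p
    rw [Ultrafilter.map_map]
    have : (φ a) ∘ ι = id := by
      funext x
      show FreeMonoid.map _ (FreeMonoid.map _ x) = x
      rw [FreeMonoid.map_map]
      exact congrFun (congrArg DFunLike.coe FreeMonoid.map_id) x
    rw [this, Ultrafilter.map_id]
  have hφX : ∀ a, X.map (φ a) = pure (FreeMonoid.of a) := by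
    intro a
    show Ultrafilter.map _ (pure _) = _
    rw [Ultrafilter.map_pure]
    rfl
  obtain ⟨f, ⟨j, hj⟩, hf⟩ := exists_idempotent_in_compact_subsemigroup
    (M := Ultrafilter (FreeMonoid (Option A))) Ultrafilter.continuous_mul_left
    (Set.range (· * (P * X * P))) (Set.range_nonempty _)
    (isCompact_range (Ultrafilter.continuous_mul_left _))
    (by rintro _ ⟨x, rfl⟩ _ ⟨y, rfl⟩; exact ⟨x * (P * X * P) * y, by simp only [mul_assoc]⟩)
  refine ⟨p, P * j * P, hp, fun a => ?_⟩
  have hja : j.map (φ a) * (p * pure (FreeMonoid.of a) * p) = f.map (φ a) := by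
    rw [← hj]
    simp only [uf_map_mul, hφP, hφX]
  have hfa : f.map (φ a) * f.map (φ a) = f.map (φ a) := by
    rw [← uf_map_mul, hf]
  have h1 := min_idem_right hmin hfa (by
    rw [← hja]; simp only [mul_assoc, hp])
  rw [← hja] at h1
  have h2 := min_idem_swap hp hmin (j := j.map (φ a)) (a := pure (FreeMonoid.of a))
    (by simpa only [mul_assoc] using h1)
  have h3 : (P * j * P).map (φ a) = p * j.map (φ a) * p := by
    simp only [uf_map_mul, hφP]
  show p * pure (FreeMonoid.of a) * (P * j * P).map (φ a) = p
  rw [h3]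
  simpa only [mul_assoc] using h2

theorem hj_lists {A κ : Type*} [Finite A] [Finite κ] (c : List A → κ) :
    ∃ (D : Set (List A)) (k : κ) (v : ℕ → List (Option A)), D.Nonempty ∧ (∀ y ∈ D, c y = k) ∧
      ∀ y ∈ D, ∀ a : A, y ++ a :: (v y.length).map (fun o => o.getD a) ∈ D := by
  obtain ⟨p, q, hp, hq⟩ := hj_uf A
  obtain ⟨k, hk⟩ : ∃ k, ∀ᶠ y in p, c (FreeMonoid.toList y) = k := by
    obtain ⟨k, hk⟩ := Ultrafilter.eq_pure_of_finite (p.map (fun y => c (FreeMonoid.toList y)))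
    refine ⟨k, ?_⟩
    have : ∀ᶠ z in (p.map (fun y => c (FreeMonoid.toList y))), z = k := by
      rw [hk]; exact (Filter.eventually_pure (p := fun z => z = k) (a := k)).2 rfl
    exact this
  let C : Set (FreeMonoid A) := {y | c (FreeMonoid.toList y) = k}
  have hC : ∀ᶠ y in p, y ∈ C := hk
  have mulp : ∀ P : FreeMonoid A → Prop, (∀ᶠ y in p, P y) ↔ ∀ᶠ y in p, ∀ᶠ z in p, P (y * z) := by
    intro P
    conv_lhs => rw [← hp]
    rfl
  have mulq : ∀ a, ∀ P : FreeMonoid A → Prop, (∀ᶠ y in p, P y) ↔ ∀ᶠ y in p, ∀ᶠ v in q,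
      P (y * FreeMonoid.of a * FreeMonoid.map (fun o : Option A => o.getD a) v) := by
    intro a P
    conv_lhs => rw [← hq a]
    rfl
  let E : Set (FreeMonoid A) := {y | y ∈ C ∧ ∀ᶠ z in p, y * z ∈ C}
  have hE : ∀ᶠ y in p, y ∈ E := hC.and ((mulp _).1 hC)
  have hE2 : ∀ y ∈ E, ∀ᶠ z in p, y * z ∈ E := by
    intro y hy
    refine hy.2.and ?_
    have := (mulp _).1 hy.2
    simpa only [mul_assoc] using this
  let Q : Set (FreeMonoid A) := {y | ∀ a, ∀ᶠ v in q,
    y * FreeMonoid.of a * FreeMonoid.map (fun o : Option A => o.getD a) v ∈ E}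
  have hQ : ∀ᶠ y in p, y ∈ Q := Filter.eventually_all.2 fun a => (mulq a _).1 hE
  have hQ2 : ∀ y ∈ E, ∀ᶠ z in p, y * z ∈ Q := by
    intro y hy
    refine Filter.eventually_all.2 fun a => ?_
    have := (mulq a _).1 (hE2 y hy)
    simpa only [mul_assoc] using this
  let D : Set (FreeMonoid A) := {y | y ∈ C ∧ y ∈ Q}
  have key : ∀ n : ℕ, ∃ v : List (Option A), ∀ y : List A, y ∈ (D : Set (List A)) → y.length = n →
      ∀ a : A, y ++ a :: v.map (fun o => o.getD a) ∈ (D : Set (List A)) := by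
    intro n
    have hfin : Finite {y : List A // y.length = n} := List.finite_length_eq A n
    have h1 : ∀ᶠ v in q, ∀ y : {y : List A // y.length = n}, ∀ a : A, FreeMonoid.ofList y.1 ∈ D →
        FreeMonoid.ofList y.1 * FreeMonoid.of a * FreeMonoid.map (fun o : Option A => o.getD a) v ∈ E := by
      refine Filter.eventually_all.2 fun y => Filter.eventually_all.2 fun a => ?_
      by_cases hy : FreeMonoid.ofList y.1 ∈ D
      · exact (hy.2 a).mono fun v hv _ => hv
      · exact Filter.Eventually.of_forall fun v h => absurd h hy
    obtain ⟨v, hv⟩ := h1.exists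
    have h2 : ∀ᶠ t in p, ∀ y : {y : List A // y.length = n}, ∀ a : A, FreeMonoid.ofList y.1 ∈ D →
        FreeMonoid.ofList y.1 * FreeMonoid.of a * FreeMonoid.map (fun o : Option A => o.getD a) v * t ∈ D := by
      refine Filter.eventually_all.2 fun y => Filter.eventually_all.2 fun a => ?_
      by_cases hy : FreeMonoid.ofList y.1 ∈ D
      · have := hv y a hy
        exact ((hE2 _ this).and (hQ2 _ this)).mono fun t ht _ => ⟨ht.1.1, ht.2⟩
      · exact Filter.Eventually.of_forall fun v h => absurd h hy
    obtain ⟨t, ht⟩ := h2.exists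
    refine ⟨FreeMonoid.toList v ++ (FreeMonoid.toList t).map some, fun y hy hyn a => ?_⟩
    have h3 : y ++ a :: (FreeMonoid.toList v ++ (FreeMonoid.toList t).map some).map (fun o => o.getD a)
        = (y ++ [a] ++ List.map (fun o => o.getD a) (FreeMonoid.toList v)) ++ FreeMonoid.toList t := by
      simp [Function.comp_def]
    rw [h3]
    exact ht ⟨y, hyn⟩ a hy
  choose v hv using key
  obtain ⟨y, hy⟩ := (hC.and hQ).exists
  exact ⟨D, k, v, ⟨y, hy⟩, fun y hy => hy.1, fun y hy a => hv _ y hy rfl a⟩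
end UF

/-- Infinite parameter words: `h i` is the first occurrence of the parameter `i` in `W`. -/
def IsPW (W h : ℕ → ℕ) : Prop := (∀ i, W (h i) = i) ∧ ∀ i n, n < h i → W n < i

/-- Substitution of a finite word in an infinite parameter word. -/
def pwAct {α : Type*} [Inhabited α] (W h : ℕ → ℕ) (u : List α) : List α :=
  (List.range (h u.length)).map (fun n => u.getD (W n) default)

/-- Finite parameter words with exactly `k` parameters. -/
inductive Rigid : ℕ → List ℕ → Prop
  | nil : Rigid 0 []
  | old {k : ℕ} {u : List ℕ} {c : ℕ} : Rigid k u → c < k → Rigid k (u ++ [c])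
  | new {k : ℕ} {u : List ℕ} : Rigid k u → Rigid (k + 1) (u ++ [k])

namespace IsPW
variable {W h V g : ℕ → ℕ}

theorem strictMono (H : IsPW W h) : StrictMono h := by
  intro i j hij
  by_contra hlt
  rcases (not_lt.1 hlt).eq_or_lt with he | hl
  · have h1 := H.1 j
    rw [he, H.1 i] at h1
    omega
  · have h1 := H.2 i _ hl
    rw [H.1 j] at h1
    omega

theorem zero (H : IsPW W h) : h 0 = 0 := by
  by_contra h0
  exact absurd (H.2 0 0 (Nat.pos_of_ne_zero h0)) (by omega)

theorem comp (H : IsPW W h) (G : IsPW V g) : IsPW (V ∘ W) (h ∘ g) :=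
  ⟨fun i => by simp [H.1, G.1], fun i n hn => G.2 _ _ (H.2 _ _ hn)⟩

theorem id : IsPW (fun n => n) (fun n => n) := ⟨fun _ => rfl, fun _ _ h => h⟩

theorem fix_h (H : IsPW W h) {m : ℕ} (hm : h m = m) {i : ℕ} (hi : i ≤ m) : h i = i := by
  have h1 := H.strictMono.le_apply (x := i)
  have h2 := H.strictMono.add_le_nat (m - i) i
  have h3 : m - i + i = m := by omega
  rw [h3, hm] at h2
  omega

theorem fix_W (H : IsPW W h) {m : ℕ} (hm : h m = m) {i : ℕ} (hi : i ≤ m) : W i = i := by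
  have h1 := H.1 i
  rwa [H.fix_h hm hi] at h1

end IsPW

section act
variable {α β : Type*} [Inhabited α] [Inhabited β] {W h V g : ℕ → ℕ}

@[simp] theorem pwAct_length (u : List α) : (pwAct W h u).length = h u.length := by
  simp [pwAct]

theorem pwAct_comp (H : IsPW W h) (u : List α) :
    pwAct W h (pwAct V g u) = pwAct (V ∘ W) (h ∘ g) u := by
  apply List.ext_getElem
  · simp
  · intro n h1 h2
    simp at h1
    have h3 : W n < g u.length := H.2 _ _ h1
    simp [pwAct, List.getElem?_range h3]

theorem pwAct_map (H : IsPW W h) (f : α → β) (u : List α) :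
    (pwAct W h u).map f = pwAct W h (u.map f) := by
  apply List.ext_getElem
  · simp
  · intro n h1 h2
    simp at h1
    have h3 : W n < u.length := H.2 _ _ h1
    simp [pwAct, List.getElem?_eq_getElem h3]

theorem pwAct_nil (H : IsPW W h) : pwAct W h ([] : List α) = [] := by
  simp [pwAct, H.zero]

theorem pwAct_cons (H : IsPW W h) (u : List α) (a : α) (v : List α) :
    ∃ r, pwAct W h (u ++ a :: v) = pwAct W h u ++ a :: r ∧ ∀ x ∈ r, x ∈ u ++ a :: v := by
  have hlt : h u.length < h (u ++ a :: v).length := H.strictMono (by simp)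
  obtain ⟨b, hb⟩ : ∃ b, h (u ++ a :: v).length = h u.length + (b + 1) :=
    ⟨h (u ++ a :: v).length - h u.length - 1, by omega⟩
  refine ⟨(List.range b).map fun n => (u ++ a :: v).getD (W (h u.length + (n + 1))) default, ?_, ?_⟩
  · unfold pwAct
    rw [hb, List.range_add, List.map_append]
    congr 1
    · apply List.map_congr_left
      intro n hn
      have h3 : W n < u.length := H.2 _ _ (List.mem_range.1 hn)
      simp [List.getElem?_append_left h3]
    · rw [List.range_succ_eq_map]
      simp [H.1, Function.comp_def]
  · intro x hx
    obtain ⟨n, hn, rfl⟩ := List.mem_map.1 hx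
    have h3 : W (h u.length + (n + 1)) < (u ++ a :: v).length := by
      apply H.2
      rw [hb]
      have := List.mem_range.1 hn
      omega
    rw [List.getD_eq_getElem _ _ h3]
    exact List.getElem_mem _

theorem pwAct_fix (H : IsPW W h) {u : List α} (hm : h u.length = u.length) : pwAct W h u = u := by
  apply List.ext_getElem
  · simp [hm]
  · intro n h1 h2
    have : W n = n := H.fix_W hm (by omega)
    simp [pwAct, this, List.getElem?_eq_getElem h2]

end act

namespace Rigid

theorem lt {k : ℕ} {u : List ℕ} (H : Rigid k u) : ∀ x ∈ u, x < k := by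
  induction H with
  | nil => simp
  | old _ hc ih => 
    intro x hx
    rcases List.mem_append.1 hx with h | h
    · exact ih x h
    · simp at h; omega
  | new _ ih =>
    intro x hx
    rcases List.mem_append.1 hx with h | h
    · have := ih x h; omega
    · simp at h; omega

theorem mem {k : ℕ} {u : List ℕ} (H : Rigid k u) : ∀ i < k, i ∈ u := by
  induction H with
  | nil => simp
  | old _ hc ih => intro i hi; simp [ih i hi]
  | new _ ih =>
    intro i hi
    rcases Nat.lt_succ_iff_lt_or_eq.1 hi with h | h
    · simp [ih i h]
    · simp [h]

theorem append {k : ℕ} {u : List ℕ} (H : Rigid k u) (v : List ℕ) (hv : ∀ x ∈ v, x < k) :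
    Rigid k (u ++ v) := by
  induction v using List.reverseRecOn with
  | nil => simpa
  | append_singleton v a ih =>
    rw [← List.append_assoc]
    exact (ih fun x hx => hv x (by simp [hx])).old (hv a (by simp))

theorem split {k : ℕ} {u : List ℕ} (H : Rigid (k + 1) u) :
    ∃ u1 u2, u = u1 ++ k :: u2 ∧ Rigid k u1 ∧ ∀ x ∈ u2, x ≤ k := by
  generalize hk : k + 1 = k' at H
  induction H with
  | nil => omega
  | @old _ u c _ hc ih =>
    obtain ⟨u1, u2, rfl, h1, h2⟩ := ih hk
    refine ⟨u1, u2 ++ [c], by simp, h1, ?_⟩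
    intro x hx
    rcases List.mem_append.1 hx with h | h
    · exact h2 x h
    · simp at h; omega
  | @new k' u hu ih =>
    obtain rfl : k = k' := by omega
    exact ⟨u, [], rfl, hu, by simp⟩

theorem act {W h : ℕ → ℕ} (P : IsPW W h) {k : ℕ} {u : List ℕ} (H : Rigid k u) :
    Rigid k (pwAct W h u) := by
  induction H with
  | nil => rw [pwAct_nil P]; exact .nil
  | @old k u c hu hc ih =>
    obtain ⟨r, hr, hr2⟩ := pwAct_cons P u c []
    rw [hr]
    refine ih.append _ fun x hx => (hu.old hc).lt x ?_
    rcases List.mem_cons.1 hx with rfl | hx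
    · simp
    · exact hr2 x hx
  | @new k u hu ih =>
    obtain ⟨r, hr, hr2⟩ := pwAct_cons P u k []
    rw [hr, List.append_cons]
    exact ih.new.append _ fun x hx => hu.new.lt x (hr2 x hx)

end Rigid

theorem pw_build (d X : ℕ → List ℕ) (hd : ∀ i, ∀ x ∈ d i, x ≤ i) (h0 : X 0 = [])
    (hX : ∀ i, X (i + 1) = X i ++ i :: d i) :
    ∃ V g, IsPW V g ∧ (∀ i, g i = (X i).length) ∧
      ∀ u : List ℕ, pwAct V g u = (X u.length).map (fun n => u.getD n default) := by
  have hpre : ∀ i j, i ≤ j → X i <+: X j := by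
    intro i j hij
    induction hij with
    | refl => exact List.prefix_rfl
    | step _ ih => exact ih.trans (by rw [hX]; exact List.prefix_append _ _)
  have hlen : ∀ i, i ≤ (X i).length := by
    intro i
    induction i with
    | zero => simp
    | succ i ih => rw [hX]; simp; omega
  have hlt : ∀ i, ∀ x ∈ X i, x < i := by
    intro i
    induction i with
    | zero => simp [h0]
    | succ i ih => 
      intro x hx
      rw [hX] at hx
      rcases List.mem_append.1 hx with h | h
      · have := ih x h; omega
      · rcases List.mem_cons.1 h with h | h
        · omega
        · have := hd i x h; omega
  let V : ℕ → ℕ := fun n => (X (n + 1)).getD n 0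
  have hV : ∀ i n, (hn : n < (X i).length) → V n = (X i)[n] := by
    intro i n hn
    have h1 : n < (X (n + 1)).length := hlen (n + 1)
    show (X (n + 1)).getD n 0 = _
    rw [List.getD_eq_getElem _ _ h1]
    rcases le_total i (n + 1) with h | h
    · exact ((hpre _ _ h).getElem hn).symm
    · exact (hpre _ _ h).getElem h1
  refine ⟨V, fun i => (X i).length, ⟨?_, ?_⟩, fun i => rfl, ?_⟩
  · intro i
    rw [hV (i + 1) _ (by rw [hX]; simp)]
    simp [hX]
  · intro i n hn
    rw [hV i n hn]
    exact hlt i _ (List.getElem_mem _)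
  · intro u
    apply List.ext_getElem
    · simp
    · intro n h1 h2
      simp at h1
      simp [pwAct, hV _ n h1]

theorem pw_zero (m : ℕ) {κ : Type*} [Finite κ] (c : List ℕ → κ) :
    ∃ V g, IsPW V g ∧ g m = m ∧ ∀ w : List ℕ, (∀ x ∈ w, x ≤ m) →
      c (pwAct V g (List.range (m + 1) ++ w)) = c (pwAct V g (List.range (m + 1))) := by
  obtain ⟨D, k, v, ⟨t0, ht0⟩, hk, hD⟩ := hj_lists (A := Fin (m + 1))
    (fun w => c (List.range (m + 1) ++ w.map Fin.val))
  let e : ℕ → ℕ → List ℕ := fun i len => if i < m then [] else if i = m then t0.map Fin.val else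
    (v (len - (m + 1))).map (fun o => (o.map Fin.val).getD i)
  let X : ℕ → List ℕ := fun i => Nat.rec [] (fun i Y => Y ++ i :: e i Y.length) i
  have hX : ∀ i, X (i + 1) = X i ++ i :: e i (X i).length := fun i => rfl
  obtain ⟨V, g, hP, hg, hact⟩ := pw_build (fun i => e i (X i).length) X (by
    intro i x hx
    simp only [e] at hx
    split_ifs at hx with h1 h2
    · simp at hx
    · obtain ⟨y, _, rfl⟩ := List.mem_map.1 hx
      have := y.2; omega
    · obtain ⟨o, _, rfl⟩ := List.mem_map.1 hx
      cases o with
      | none => simp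
      | some y => 
        have := y.2
        simp; omega) rfl hX
  have hXm : ∀ i ≤ m, X i = List.range i := by
    intro i
    induction i with
    | zero => intro _; rfl
    | succ i ih =>
      intro hi
      rw [hX, ih (by omega), List.range_succ]
      simp only [e]
      rw [if_pos (by omega)]
  have hXD : ∀ j, ∃ Y, X (m + 1 + j) = List.range (m + 1) ++ Y ∧ 
      ∀ φ : ℕ → Fin (m + 1), (∀ a : Fin (m + 1), φ a = a) → Y.map φ ∈ D := by
    intro j
    induction j with
    | zero =>
      refine ⟨t0.map Fin.val, ?_, ?_⟩
      · show X (m + 1) = _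
        rw [hX, hXm m le_rfl, List.range_succ]
        simp [e]
      · intro φ hφ
        simpa [Function.comp_def, hφ] using ht0
    | succ j ih =>
      obtain ⟨Y, hY, hYD⟩ := ih
      refine ⟨Y ++ (m + 1 + j) :: (v Y.length).map (fun o => (o.map Fin.val).getD (m + 1 + j)), ?_, ?_⟩
      · show X (m + 1 + j + 1) = _
        rw [hX, hY]
        simp only [e]
        rw [if_neg (by omega), if_neg (by omega)]
        simp
      · intro φ hφ
        have := hD _ (hYD φ hφ) (φ (m + 1 + j))
        convert this using 1
        simp only [List.map_append, List.map_cons, List.map_map, List.length_map]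
        congr 2
        apply List.map_congr_left
        intro o _
        cases o with
        | none => simp
        | some y => simp [hφ]
  have main : ∀ w : List ℕ, (∀ x ∈ w, x ≤ m) → c (pwAct V g (List.range (m + 1) ++ w)) = k := by
    intro w hw
    obtain ⟨Y, hY, hYD⟩ := hXD w.length
    let φ : ℕ → Fin (m + 1) := fun i => Fin.ofNat (m + 1) ((List.range (m + 1) ++ w).getD i 0)
    have hφ : ∀ i, (φ i : ℕ) = (List.range (m + 1) ++ w).getD i 0 := by
      intro i
      simp only [φ, Fin.ofNat]
      apply Nat.mod_eq_of_lt
      by_cases hi : i < (List.range (m + 1) ++ w).length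
      · rw [List.getD_eq_getElem _ _ hi]
        have hmem := List.getElem_mem hi
        generalize (List.range (m + 1) ++ w)[i] = z at hmem
        rcases List.mem_append.1 hmem with h | h
        · exact List.mem_range.1 h
        · have := hw z h; omega
      · rw [List.getD_eq_default _ _ (by omega)]; omega
    have hφ2 : ∀ a : Fin (m + 1), φ a = a := by
      intro a
      apply Fin.ext
      rw [hφ]
      have ha := a.2
      rw [List.getD_append _ _ _ _ (by simpa using ha)]
      simp [ha]
    have := hk _ (hYD φ hφ2)
    rw [← this, hact]
    congr 1
    have hl : (List.range (m + 1) ++ w).length = m + 1 + w.length := by simp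
    rw [hl, hY, List.map_append]
    congr 1
    · conv_rhs => rw [← List.map_id (List.range (m + 1))]
      apply List.map_congr_left
      intro n hn
      have hn := List.mem_range.1 hn
      rw [List.getD_append _ _ _ _ (by simpa using hn)]
      simp [hn]
    · rw [List.map_map]
      apply List.map_congr_left
      intro n hn
      exact (hφ n).symm
  refine ⟨V, g, hP, ?_, fun w hw => ?_⟩
  · rw [hg, hXm m le_rfl]; simp
  · rw [main w hw]
    have := main [] (by simp)
    rw [List.append_nil] at this
    exact this.symm

theorem pw_step (k m : ℕ) {κ : Type*} [Finite κ] (χ : List ℕ → κ) :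
    ∃ V g, IsPW V g ∧ g m = m ∧ ∀ u1 u2 : List ℕ, Rigid k u1 → u1.length = m → (∀ x ∈ u2, x ≤ k) →
      χ (pwAct V g (u1 ++ k :: u2)) = χ (pwAct V g (u1 ++ [k])) := by
  let ext : (Fin (m + 1) → Fin (k + 1)) → ℕ → ℕ := fun u i =>
    if h : i < m + 1 then (u ⟨i, h⟩ : ℕ) else 0
  obtain ⟨V, g, hP, hg, hc⟩ := pw_zero m
    (fun (x : List ℕ) (u : Fin (m + 1) → Fin (k + 1)) => χ (x.map (ext u)))
  refine ⟨V, g, hP, hg, fun u1 u2 hu1 hlen hu2 => ?_⟩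
  let y := u1 ++ [k]
  have hylen : y.length = m + 1 := by simp [y, hlen]
  have hyR : Rigid (k + 1) y := hu1.new
  let u : Fin (m + 1) → Fin (k + 1) := fun i => Fin.ofNat (k + 1) (y.getD i 0)
  have hext : ∀ i, ext u i = y.getD i 0 := by
    intro i
    simp only [ext]
    split_ifs with h
    · simp only [u, Fin.ofNat]
      apply Nat.mod_eq_of_lt
      rw [List.getD_eq_getElem _ _ (by omega)]
      exact hyR.lt _ (List.getElem_mem _)
    · rw [List.getD_eq_default _ _ (by omega)]
  have hsurj : ∀ x, x ≤ k → ∃ i ≤ m, ext u i = x := by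
    intro x hx
    obtain ⟨i, hi, hix⟩ := List.getElem_of_mem (hyR.mem x (by omega))
    refine ⟨i, by omega, ?_⟩
    rw [hext, List.getD_eq_getElem _ _ hi, hix]
  have hw : ∃ w : List ℕ, (∀ x ∈ w, x ≤ m) ∧ w.map (ext u) = u2 := by
    clear_value y
    induction u2 with
    | nil => exact ⟨[], by simp, rfl⟩
    | cons a u2 ih =>
      obtain ⟨w, h1, h2⟩ := ih (fun x hx => hu2 x (by simp [hx]))
      obtain ⟨i, hi, hia⟩ := hsurj a (hu2 a (by simp))
      refine ⟨i :: w, ?_, by simp [h2, hia]⟩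
      intro x hx
      rcases List.mem_cons.1 hx with rfl | hx
      · exact hi
      · exact h1 x hx
  obtain ⟨w, hw1, hw2⟩ := hw
  have hr : (List.range (m + 1)).map (ext u) = y := by
    apply List.ext_getElem
    · simp [hylen]
    · intro n h1 h2
      simp [hext, h2]
  have := congrFun (hc w hw1) u
  simp only [pwAct_map hP, List.map_append, hr, hw2] at this
  simpa [y] using this

/-- The colour of `W[u₁ k u₂]` depends on `u₁` only, for `u₁` of length `m`. -/
def TailConst {κ : Type*} (χ : List ℕ → κ) (k m : ℕ) (W h : ℕ → ℕ) : Prop :=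
  ∀ u1 u2 : List ℕ, Rigid k u1 → u1.length = m → (∀ x ∈ u2, x ≤ k) →
      χ (pwAct W h (u1 ++ k :: u2)) = χ (pwAct W h (u1 ++ [k]))

theorem pwAct_fix_cons {V g : ℕ → ℕ} (hV : IsPW V g) {m m' k : ℕ} (hg : g m' = m') (hm : m ≤ m')
    {u1 u2 : List ℕ} (h1 : Rigid k u1) (hl : u1.length = m) (h2 : ∀ x ∈ u2, x ≤ k) :
    ∃ r, pwAct V g (u1 ++ k :: u2) = u1 ++ k :: r ∧ ∀ x ∈ r, x ≤ k := by
  obtain ⟨r, hr, hr2⟩ := pwAct_cons hV u1 k u2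
  refine ⟨r, ?_, ?_⟩
  · rw [hr, pwAct_fix hV (hV.fix_h hg (by omega))]
  · intro x hx
    have := hr2 x hx
    rw [List.mem_append, List.mem_cons] at this
    rcases this with h | h | h
    · exact (h1.lt x h).le
    · omega
    · exact h2 x h

theorem TailConst.comp {κ : Type*} {χ : List ℕ → κ} {k m m' : ℕ} {W h V g : ℕ → ℕ}
    (H : TailConst χ k m W h) (hW : IsPW W h) (hV : IsPW V g) (hg : g m' = m') (hm : m ≤ m') :
    TailConst χ k m (V ∘ W) (h ∘ g) := by
  intro u1 u2 h1 hl h2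
  rw [← pwAct_comp hW, ← pwAct_comp hW]
  obtain ⟨r, hr, hr2⟩ := pwAct_fix_cons hV hg hm h1 hl h2
  obtain ⟨r', hr', hr2'⟩ := pwAct_fix_cons hV hg hm h1 hl (u2 := []) (by simp)
  rw [hr, hr', H u1 r h1 hl hr2, H u1 r' h1 hl hr2']

theorem pw_fusion (k : ℕ) {κ : Type*} [Finite κ] (χ : List ℕ → κ) :
    ∃ W h, IsPW W h ∧ ∀ m, TailConst χ k m W h := by
  have step : ∀ (m : ℕ) (x : {x : (ℕ → ℕ) × (ℕ → ℕ) // IsPW x.1 x.2}),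
      ∃ y : {x : (ℕ → ℕ) × (ℕ → ℕ) // IsPW x.1 x.2},
        (∃ V g, IsPW V g ∧ g m = m ∧ y.1 = (V ∘ x.1.1, x.1.2 ∘ g)) ∧
          TailConst χ k m y.1.1 y.1.2 := by
    rintro m ⟨⟨W, h⟩, hW⟩
    obtain ⟨V, g, hV, hg, hc⟩ := pw_step k m (fun u => χ (pwAct W h u))
    refine ⟨⟨(V ∘ W, h ∘ g), hW.comp hV⟩, ⟨V, g, hV, hg, rfl⟩, ?_⟩
    intro u1 u2 h1 hl h2
    have := hc u1 u2 h1 hl h2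
    simpa only [pwAct_comp hW] using this
  choose next hn1 hn2 using step
  let F : ℕ → {x : (ℕ → ℕ) × (ℕ → ℕ) // IsPW x.1 x.2} := fun m =>
    Nat.rec ⟨(fun n => n, fun n => n), IsPW.id⟩ (fun m x => next m x) m
  have hF : ∀ m, F (m + 1) = next m (F m) := fun m => rfl
  have hFW : ∀ m n, n ≤ m → (F (m + 1)).1.1 n = (F m).1.1 n := by
    intro m n hn
    obtain ⟨V, g, hV, hg, he⟩ := hn1 m (F m)
    rw [hF, he]
    apply hV.fix_W hg
    have h1 := (F m).2.strictMono.le_apply (x := m + 1)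
    have h2 := (F m).2.2 (m + 1) n (by omega)
    omega
  have hFh : ∀ m n, n ≤ m → (F (m + 1)).1.2 n = (F m).1.2 n := by
    intro m n hn
    obtain ⟨V, g, hV, hg, he⟩ := hn1 m (F m)
    rw [hF, he]
    simp only [Function.comp]
    rw [hV.fix_h hg hn]
  let W : ℕ → ℕ := fun n => (F n).1.1 n
  let h : ℕ → ℕ := fun n => (F n).1.2 n
  have hW : ∀ n M, n ≤ M → (F M).1.1 n = W n := by
    intro n M hM
    induction M, hM using Nat.le_induction with
    | base => rfl
    | succ M hM ih => rw [hFW M n hM, ih]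
  have hh : ∀ n M, n ≤ M → (F M).1.2 n = h n := by
    intro n M hM
    induction M, hM using Nat.le_induction with
    | base => rfl
    | succ M hM ih => rw [hFh M n hM, ih]
  have hPW : IsPW W h := by
    constructor
    · intro i
      have h1 := (F (max i (h i))).2.1 i
      rwa [hh i _ (le_max_left _ _), hW _ _ (le_max_right _ _)] at h1
    · intro i n hn
      have h1 := (F (max i n)).2.2 i n
      rw [hh i _ (le_max_left _ _), hW _ _ (le_max_right _ _)] at h1
      exact h1 hn
  refine ⟨W, h, hPW, fun m => ?_⟩
  have hT : ∀ M, m + 1 ≤ M → TailConst χ k m (F M).1.1 (F M).1.2 := by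
    intro M hM
    induction M, hM using Nat.le_induction with
    | base => exact hn2 m (F m)
    | succ M hM ih =>
      obtain ⟨V, g, hV, hg, he⟩ := hn1 M (F M)
      rw [hF, he]
      exact ih.comp (F M).2 hV hg (by omega)
  have hact : ∀ (u : List ℕ) M, u.length ≤ M → h u.length ≤ M →
      pwAct W h u = pwAct (F M).1.1 (F M).1.2 u := by
    intro u M h1 h2
    unfold pwAct
    rw [hh _ _ h1]
    apply List.map_congr_left
    intro n hn
    rw [hW n M (by have := List.mem_range.1 hn; omega)]
  intro u1 u2 h1 hl h2
  let M := m + 1 + (u1 ++ k :: u2).length + h (u1 ++ k :: u2).length + (u1 ++ [k]).length + 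
    h (u1 ++ [k]).length
  rw [hact _ M (by omega) (by omega), hact _ M (by omega) (by omega)]
  exact hT M (by omega) u1 u2 h1 hl h2

/-- Carlson-Simpson theorem for finite parameter words over the empty alphabet. -/
theorem carlson_simpson_s16 (k : ℕ) {κ : Type*} [Finite κ] (χ : List ℕ → κ) :
    ∃ W h, IsPW W h ∧ ∀ u v, Rigid k u → Rigid k v → χ (pwAct W h u) = χ (pwAct W h v) := by
  induction k generalizing χ with
  | zero =>
    refine ⟨_, _, IsPW.id, fun u v hu hv => ?_⟩
    have h0 : ∀ u, Rigid 0 u → u = [] := fun u hu =>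
      List.eq_nil_iff_forall_not_mem.2 fun x hx => absurd (hu.lt x hx) (by omega)
    rw [h0 u hu, h0 v hv]
  | succ k ih =>
    obtain ⟨W, h, hW, hT⟩ := pw_fusion k χ
    obtain ⟨V, g, hV, hc⟩ := ih (fun u => χ (pwAct W h (u ++ [k])))
    have key : ∀ u, Rigid (k + 1) u → ∃ u1, Rigid k u1 ∧
        χ (pwAct W h (pwAct V g u)) = χ (pwAct W h (pwAct V g u1 ++ [k])) := by
      intro u hu
      obtain ⟨u1, u2, rfl, h1, h2⟩ := hu.split
      obtain ⟨r, hr, hr2⟩ := pwAct_cons hV u1 k u2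
      refine ⟨u1, h1, ?_⟩
      rw [hr]
      exact hT _ _ _ (h1.act hV) rfl fun x hx => Nat.lt_succ_iff.1 (hu.lt x (hr2 x hx))
    refine ⟨_, _, hW.comp hV, fun u v hu hv => ?_⟩
    rw [← pwAct_comp hW, ← pwAct_comp hW]
    obtain ⟨u1, h1, e1⟩ := key u hu
    obtain ⟨v1, h2, e2⟩ := key v hv
    rw [e1, e2]
    exact hc u1 v1 h1 h2

/-! ### Envelopes -/

theorem pwAct_takeWhile {W h : ℕ → ℕ} (H : IsPW W h) (l : ℕ) (u : List ℕ) :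
    (pwAct W h u).takeWhile (· < l) = pwAct W h (u.takeWhile (· < l)) := by
  have hall : ∀ v : List ℕ, (∀ x ∈ v, x < l) → ∀ x ∈ pwAct W h v, x < l := by
    intro v hv x hx
    obtain ⟨n, hn, rfl⟩ := List.mem_map.1 hx
    have h3 : W n < v.length := H.2 _ _ (List.mem_range.1 hn)
    rw [List.getD_eq_getElem _ _ h3]
    exact hv _ (List.getElem_mem _)
  have htw : ∀ x ∈ u.takeWhile (· < l), x < l := by
    intro x hx
    simpa using List.mem_takeWhile_imp hx
  have hsplit := List.takeWhile_append_dropWhile (p := fun x => decide (x < l)) (l := u)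
  cases hd : u.dropWhile (· < l) with
  | nil =>
    rw [hd, List.append_nil] at hsplit
    rw [hsplit] at htw ⊢
    rw [List.takeWhile_eq_self_iff]
    intro x hx
    simpa using hall u htw x hx
  | cons a v =>
    have ha : ¬ a < l := by
      have := List.head_dropWhile_not (fun x => decide (x < l)) (l := u) (by rw [hd]; simp)
      simpa [hd] using this
    rw [hd] at hsplit
    obtain ⟨r, hr, _⟩ := pwAct_cons H (u.takeWhile (· < l)) a v
    conv_lhs => rw [← hsplit, hr]
    rw [List.takeWhile_append_of_pos]
    · simp [ha]
    · intro x hx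
      simpa using hall _ htw x hx

theorem Rigid.takeWhile {k : ℕ} {u : List ℕ} (H : Rigid k u) (P : ℕ → Bool) (l : ℕ)
    (h1 : ∀ i < l, P i = true) (h2 : P l = false ∨ k ≤ l) :
    u.takeWhile P = u.takeWhile (· < l) := by
  induction H with
  | nil => rfl
  | @old k u c hu hc ih =>
    have ih := ih h2
    rw [List.takeWhile_append, List.takeWhile_append, ih]
    split_ifs with hl
    · congr 1
      have heq : u.takeWhile (· < l) = u := (List.takeWhile_sublist _).eq_of_length hl
      rw [heq] at ih
      rcases h2 with h2 | h2
      · have hkl : k ≤ l := by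
          by_contra hk
          have := List.takeWhile_eq_self_iff.1 ih l (hu.mem l (by omega))
          rw [h2] at this; cases this
        have hcl : c < l := by omega
        simp [h1 c hcl, hcl]
      · have hcl : c < l := by omega
        simp [h1 c hcl, hcl]
    · rfl
  | @new k u hu ih =>
    have ih := ih (h2.imp_right fun h => by omega)
    rw [List.takeWhile_append, List.takeWhile_append, ih]
    split_ifs with hl
    · congr 1
      have heq : u.takeWhile (· < l) = u := (List.takeWhile_sublist _).eq_of_length hl
      have hkl : k ≤ l := by
        by_contra hk
        have := List.takeWhile_eq_self_iff.1 heq l (hu.mem l (by omega))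
        simp at this
      rcases hkl.eq_or_lt with rfl | hkl
      · rcases h2 with h2 | h2
        · simp [h2]
        · omega
      · simp [h1 k hkl, hkl]
    · rfl

theorem exists_rigid_factor {Γ : Type*} [Inhabited Γ] (c : List Γ) :
    ∃ (γ : List Γ) (u : List ℕ), γ.Nodup ∧ Rigid γ.length u ∧ c = u.map (fun n => γ.getD n default) := by
  induction c using List.reverseRecOn with
  | nil => exact ⟨[], [], List.nodup_nil, .nil, rfl⟩
  | append_singleton c a ih =>
    obtain ⟨γ, u, hγ, hu, rfl⟩ := ih
    by_cases ha : a ∈ γ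
    · obtain ⟨i, hi, hia⟩ := List.getElem_of_mem ha
      refine ⟨γ, u ++ [i], hγ, hu.old hi, ?_⟩
      simp [hi, hia]
    · refine ⟨γ ++ [a], u ++ [γ.length], ?_, ?_, ?_⟩
      · rw [← List.concat_eq_append]; exact hγ.concat ha
      · rw [List.length_append]; exact hu.new
      · rw [List.map_append]
        congr 1
        · apply List.map_congr_left
          intro n hn
          rw [List.getD_append _ _ _ _ (hu.lt n hn)]
        · simp

theorem Rigid.pad {k : ℕ} {u : List ℕ} (H : Rigid k u) {K : ℕ} (hK : k ≤ K) :
    ∃ u', Rigid K u' ∧ ∀ l ≤ k, u'.takeWhile (· < l) = u.takeWhile (· < l) := by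
  induction K, hK using Nat.le_induction with
  | base => exact ⟨u, H, fun _ _ => rfl⟩
  | succ K hK ih =>
    obtain ⟨u', h1, h2⟩ := ih
    refine ⟨u' ++ [K], h1.new, fun l hl => ?_⟩
    rw [← h2 l hl, List.takeWhile_append]
    split_ifs with h
    · have : (u'.takeWhile (· < l)) = u' := (List.takeWhile_sublist _).eq_of_length h
      rw [this, List.takeWhile_cons_of_neg (by simp; omega), List.append_nil]
    · rfl

theorem exists_envelope {M A : Type*} [Finite M] [Finite A] [Inhabited A] :
    ∃ K : ℕ, ∀ a : M → List A, ∃ (u : List ℕ) (b : M → List A), Rigid K u ∧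
      (∀ j, (b j).length ≤ K) ∧
      ∀ j, a j = (u.takeWhile (· < (b j).length)).map (fun n => (b j).getD n default) := by
  classical
  have := Fintype.ofFinite M
  have := Fintype.ofFinite A
  refine ⟨Fintype.card (M → Option A), fun a => ?_⟩
  let L := ∑ j, (a j).length
  have hL : ∀ j, (a j).length ≤ L := fun j =>
    Finset.single_le_sum (f := fun j => (a j).length) (fun _ _ => Nat.zero_le _) (Finset.mem_univ j)
  obtain ⟨γ, u, hγ, hu, hc⟩ := exists_rigid_factor
    ((List.range L).map (fun p (j : M) => (a j)[p]?))
  have hcard : γ.length ≤ Fintype.card (M → Option A) := hγ.length_le_card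
  obtain ⟨u', hu', htw⟩ := hu.pad hcard
  let s : ℕ → M → Option A := fun n => γ.getD n default
  let P : M → ℕ → Bool := fun j n => (s n j).isSome
  have hex : ∀ j, ∃ l, l ≤ γ.length ∧ (∀ i < l, P j i = true) ∧ (P j l = false ∨ γ.length ≤ l) := by
    intro j
    have hex0 : ∃ l, P j l = false ∨ γ.length ≤ l := ⟨γ.length, Or.inr le_rfl⟩
    refine ⟨Nat.find hex0, Nat.find_min' hex0 (Or.inr le_rfl), fun i hi => ?_, Nat.find_spec hex0⟩
    have := Nat.find_min hex0 hi
    rw [not_or] at this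
    simpa using this.1
  choose l hl1 hl2 hl3 using hex
  refine ⟨u', fun j => (List.range (l j)).map (fun n => (s n j).getD default), hu', ?_, ?_⟩
  · intro j; rw [List.length_map, List.length_range]; exact (hl1 j).trans hcard
  · intro j
    simp only [List.length_map, List.length_range]
    rw [htw (l j) (hl1 j)]
    have e1 := hu.takeWhile (P j) (l j) (hl2 j) (hl3 j)
    have e2 : (u.takeWhile (· < l j)).map (fun n => ((List.range (l j)).map
        (fun n => (s n j).getD default)).getD n default) =
        (u.takeWhile (· < l j)).map (fun n => (s n j).getD default) := by
      apply List.map_congr_left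
      intro n hn
      have : n < l j := by simpa using List.mem_takeWhile_imp hn
      simp [this]
    rw [e2, ← e1]
    have e3 : (u.takeWhile (P j)).map (fun n => (s n j).getD default) =
        ((u.map s).takeWhile (fun f => (f j).isSome)).map (fun f => (f j).getD default) := by
      rw [List.takeWhile_map, List.map_map]
      rfl
    have e4 : u.map s = (List.range L).map (fun p (j : M) => (a j)[p]?) := hc.symm
    rw [e3, e4, List.takeWhile_map, List.map_map]
    obtain ⟨d, hd⟩ := Nat.exists_eq_add_of_le (hL j)
    rw [hd, List.range_add, List.takeWhile_append_of_pos]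
    · have : List.takeWhile ((fun f : M → Option A => (f j).isSome) ∘ fun p (j : M) => (a j)[p]?)
          ((List.range d).map (fun x => (a j).length + x)) = [] := by
        cases d with
        | zero => rfl
        | succ d => rw [List.range_succ_eq_map]; simp
      rw [this, List.append_nil]
      apply List.ext_getElem
      · simp
      · intro n h1 h2
        simp [h1]
    · intro n hn
      simpa using hn

/-! ### The coding space of words -/

open Classical in
/-- The distance on words: for `|u| < |v|` it is the letter of `v` at position `|u|`. -/
noncomputable def wdist {A : Type*} [Inhabited A] (val : A → ℝ) (u v : List A) : ℝ :=
  if u = v then 0 else if u.length < v.length then val (v.getD u.length default)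
  else if v.length < u.length then val (u.getD v.length default) else val default

section wdist
variable {A : Type*} [Inhabited A] (val : A → ℝ)

theorem wdist_comm (u v : List A) : wdist val u v = wdist val v u := by
  unfold wdist
  by_cases h : u = v
  · simp [h]
  · rw [if_neg h, if_neg (Ne.symm h)]
    split_ifs <;> first | rfl | omega

theorem wdist_mem {S : Finset ℝ} (h0 : (0 : ℝ) ∈ S) (hval : ∀ x, val x ∈ S ∧ val x ≠ 0)
    (u v : List A) : wdist val u v ∈ S := by
  unfold wdist
  split_ifs
  · exact h0
  all_goals exact (hval _).1

theorem wdist_eq {S : Finset ℝ} (hval : ∀ x, val x ∈ S ∧ val x ≠ 0)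
    {u v : List A} (h : wdist val u v = 0) : u = v := by
  unfold wdist at h
  split_ifs at h with h1
  · exact h1
  all_goals exact absurd h (hval _).2

theorem pwAct_injective {W h : ℕ → ℕ} (hW : IsPW W h) {u v : List A}
    (huv : pwAct W h u = pwAct W h v) : u = v := by
  have hl := congrArg List.length huv
  simp only [pwAct_length] at hl
  have hl := hW.strictMono.injective hl
  apply List.ext_getElem hl
  intro n h1 h2
  have e1 : ∀ w : List A, (hn : n < w.length) → (pwAct W h w).getD (h n) default = w[n] := by
    intro w hn
    have : h n < h w.length := hW.strictMono hn
    simp [pwAct, this, hW.1, hn]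
  rw [← e1 u h1, ← e1 v h2, huv]

theorem wdist_act {W h : ℕ → ℕ} (hW : IsPW W h) (u v : List A) :
    wdist val (pwAct W h u) (pwAct W h v) = wdist val u v := by
  have key : ∀ u v : List A, u.length < v.length →
      (pwAct W h v).getD (h u.length) default = v.getD u.length default := by
    intro u v huv
    have : h u.length < h v.length := hW.strictMono huv
    simp [pwAct, this, hW.1]
  unfold wdist
  by_cases huv : u = v
  · simp [huv]
  · have : pwAct W h u ≠ pwAct W h v := fun h' => huv (pwAct_injective hW h')
    rw [if_neg huv, if_neg this]
    simp only [pwAct_length, hW.strictMono.lt_iff_lt]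
    split_ifs with h1 h2
    · rw [key u v h1]
    · rw [key v u h2]
    · rfl

end wdist

theorem extend_one {X U : Type} [MetricSpace X] [MetricSpace U] (S : Finset ℝ)
    (huniv : ∀ (M : Type) [MetricSpace M], Finite M →
      (∀ x y : M, dist x y ∈ S) → ∃ f : M → U, Isometry f)
    (hultra : ∀ P : Set U, P.Finite → ∀ φ : P → U,
      (∀ x y : P, dist (φ x) (φ y) = dist (x : U) (y : U)) →
      ∃ h : U → U, Isometry h ∧ Function.Surjective h ∧ ∀ x : P, h x = φ x)
    (hXS : ∀ x y : X, dist x y ∈ S) (F : Set X) (hF : F.Finite) (z : X) (f : X → U)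
    (hf : ∀ x ∈ F, ∀ y ∈ F, dist (f x) (f y) = dist x y) :
    ∃ f' : X → U, (∀ x ∈ F, f' x = f x) ∧
      ∀ x ∈ insert z F, ∀ y ∈ insert z F, dist (f' x) (f' y) = dist x y := by
  classical
  by_cases hz : z ∈ F
  · exact ⟨f, fun _ _ => rfl, by rw [Set.insert_eq_of_mem hz]; exact hf⟩
  have hfin : Finite ↥(insert z F) := (hF.insert z).to_subtype
  obtain ⟨j, hj⟩ := huniv ↥(insert z F) hfin (fun x y => hXS x y)
  let P : Set U := {p | ∃ x : ↥(insert z F), x.1 ∈ F ∧ j x = p}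
  have hP : P.Finite := (Set.finite_range j).subset (by rintro _ ⟨x, _, rfl⟩; exact ⟨x, rfl⟩)
  have hc : ∀ p : P, ∃ x : ↥(insert z F), x.1 ∈ F ∧ j x = p := fun p => p.2
  choose c hc1 hc2 using hc
  obtain ⟨h, hh, -, hext⟩ := hultra P hP (fun p => f (c p).1) (by
    intro p q
    rw [hf _ (hc1 p) _ (hc1 q), ← hc2 p, ← hc2 q, hj.dist_eq]
    rfl)
  let z' : ↥(insert z F) := ⟨z, Set.mem_insert _ _⟩
  have hfx : ∀ x (hx : x ∈ F), f x = h (j ⟨x, Set.mem_insert_of_mem _ hx⟩) := by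
    intro x hx
    have h1 := hext ⟨j ⟨x, Set.mem_insert_of_mem _ hx⟩, ⟨_, hx, rfl⟩⟩
    rw [h1]
    congr 1
    have h2 := hc2 ⟨j ⟨x, Set.mem_insert_of_mem _ hx⟩, ⟨_, hx, rfl⟩⟩
    exact (congrArg Subtype.val (hj.injective h2)).symm
  let f' : X → U := fun x => if x ∈ F then f x else h (j z')
  have hf' : ∀ x (hx : x ∈ insert z F), f' x = h (j ⟨x, hx⟩) := by
    intro x hx
    by_cases hxF : x ∈ F
    · simp only [f', if_pos hxF]
      exact hfx x hxF
    · simp only [f', if_neg hxF]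
      congr 2
      apply Subtype.ext
      rcases hx with h | h
      · exact h.symm
      · exact absurd h hxF
  refine ⟨f', fun x hx => if_pos hx, fun x hx y hy => ?_⟩
  rw [hf' x hx, hf' y hy, hh.dist_eq, hj.dist_eq]
  rfl

theorem embed_countable {X U : Type} [MetricSpace X] [Countable X] [Nonempty X] [Nonempty U]
    [MetricSpace U] (S : Finset ℝ)
    (huniv : ∀ (M : Type) [MetricSpace M], Finite M →
      (∀ x y : M, dist x y ∈ S) → ∃ f : M → U, Isometry f)
    (hultra : ∀ P : Set U, P.Finite → ∀ φ : P → U,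
      (∀ x y : P, dist (φ x) (φ y) = dist (x : U) (y : U)) →
      ∃ h : U → U, Isometry h ∧ Function.Surjective h ∧ ∀ x : P, h x = φ x)
    (hXS : ∀ x y : X, dist x y ∈ S) : ∃ f : X → U, Isometry f := by
  classical
  obtain ⟨x, hx⟩ := exists_surjective_nat X
  let F : ℕ → Set X := fun n => x '' Set.Iio n
  have hFfin : ∀ n, (F n).Finite := fun n => (Set.finite_Iio n).image x
  have hFs : ∀ n, F (n + 1) = insert (x n) (F n) := by
    intro n
    simp only [F]
    rw [← Set.image_insert_eq]
    congr 1
    ext i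
    simp only [Set.mem_Iio, Set.mem_insert_iff]
    omega
  have hstep : ∀ (n : ℕ) (f : {f : X → U // ∀ x ∈ F n, ∀ y ∈ F n, dist (f x) (f y) = dist x y}),
      ∃ f' : {f : X → U // ∀ x ∈ F (n + 1), ∀ y ∈ F (n + 1), dist (f x) (f y) = dist x y},
        ∀ x ∈ F n, f'.1 x = f.1 x := by
    rintro n ⟨f, hf⟩
    obtain ⟨f', h1, h2⟩ := extend_one S huniv hultra hXS (F n) (hFfin n) (x n) f hf
    exact ⟨⟨f', by rw [hFs]; exact h2⟩, h1⟩
  choose next hnext using hstep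
  let G : ∀ n, {f : X → U // ∀ x ∈ F n, ∀ y ∈ F n, dist (f x) (f y) = dist x y} := fun n =>
    Nat.rec ⟨fun _ => Classical.arbitrary U, by simp [F]⟩ (fun n f => next n f) n
  have hG : ∀ n, ∀ z ∈ F n, (G (n + 1)).1 z = (G n).1 z := fun n z hz => hnext n (G n) z hz
  have hFm : ∀ n m, n ≤ m → F n ⊆ F m := fun n m h => Set.image_mono (Set.Iio_subset_Iio h)
  have hGm : ∀ n m, n ≤ m → ∀ z ∈ F n, (G m).1 z = (G n).1 z := by
    intro n m hnm z hz
    induction m, hnm using Nat.le_induction with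
    | base => rfl
    | succ m hm ih => rw [hG m z (hFm n m hm hz), ih]
  choose idx hidx using hx
  have hmem : ∀ z, z ∈ F (idx z + 1) := fun z => ⟨idx z, by simp, hidx z⟩
  refine ⟨fun z => (G (idx z + 1)).1 z, Isometry.of_dist_eq fun y z => ?_⟩
  have h1 : idx y + 1 ≤ max (idx y + 1) (idx z + 1) := le_max_left _ _
  have h2 : idx z + 1 ≤ max (idx y + 1) (idx z + 1) := le_max_right _ _
  rw [← hGm _ _ h1 y (hmem y), ← hGm _ _ h2 z (hmem z)]
  exact (G _).2 y (hFm _ _ h1 (hmem y)) z (hFm _ _ h2 (hmem z))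

theorem stmt16 (S : Finset ℝ) (h0 : (0 : ℝ) ∈ S) (hnn : ∀ s ∈ S, 0 ≤ s)
    (s1 : ℝ) (hs1S : s1 ∈ S) (hs1pos : 0 < s1)
    (hs1min : ∀ s ∈ S, s ≠ 0 → s1 ≤ s)
    (hcds : CompactDistanceSet S s1)
    -- `S∖{0}` is a single block
    (hone : ∀ x ∈ S, x ≠ 0 → ∀ y ∈ S, y ≠ 0 → SameBlock S x y)
    -- `U` is a countably infinite `S`-metric space ...
    (U : Type) [MetricSpace U] (hUc : Countable U) (hUi : Infinite U)
    (hUS : ∀ x y : U, dist x y ∈ S)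
    -- ... universal for finite `S`-metric spaces ...
    (huniv : ∀ (M : Type) [MetricSpace M], Finite M →
      (∀ x y : M, dist x y ∈ S) → ∃ f : M → U, Isometry f)
    -- ... and ultrahomogeneous: every isometry between finite subspaces of `U`
    -- extends to a surjective self-isometry of `U`
    (hultra : ∀ P : Set U, P.Finite → ∀ φ : P → U,
      (∀ x y : P, dist (φ x) (φ y) = dist (x : U) (y : U)) →
      ∃ h : U → U, Isometry h ∧ Function.Surjective h ∧ ∀ x : P, h x = φ x)
    -- a finite `S`-metric space `M`
    (M : Type) [MetricSpace M] (hMfin : Finite M)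
    (hMS : ∀ x y : M, dist x y ∈ S) :
    ∃ T : ℕ, 0 < T ∧ ∀ k, 2 ≤ k →
      ∀ χ : {f : M → U // Isometry f} → Fin k,
        ∃ w : {g : U → U // Isometry g},
          (χ '' {p | ∃ f₀ : {f : M → U // Isometry f},
            p.val = w.val ∘ f₀.val}).ncard ≤ T := by
  have hS2 : ∀ x ∈ S, x ≠ 0 → s1 ≤ x ∧ x ≤ 2 * s1 := by
    intro x hx hx0
    refine ⟨hs1min x hx hx0, ?_⟩
    have := (hcds x hx s1 hs1S hx0 hs1pos.ne').2 (hone x hx hx0 s1 hs1S hs1pos.ne')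
    have := (abs_le.1 this).2
    linarith
  let A : Type := {s : ℝ // s ∈ S ∧ s ≠ 0}
  have hAfin : Finite A := (S.finite_toSet.subset (fun s hs => hs.1) : {s : ℝ | s ∈ S ∧ s ≠ 0}.Finite)
  let iA : Inhabited A := ⟨⟨s1, hs1S, hs1pos.ne'⟩⟩
  let val : A → ℝ := Subtype.val
  have hval : ∀ x : A, val x ∈ S ∧ val x ≠ 0 := fun x => x.2
  have hρS : ∀ u v : List A, wdist val u v ∈ S := wdist_mem val h0 hval
  obtain ⟨i, hi⟩ : ∃ i : List A → U, ∀ u v, dist (i u) (i v) = wdist val u v := by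
    let mX : MetricSpace (List A) :=
      { dist := wdist val
        dist_self := fun u => by simp [wdist]
        dist_comm := wdist_comm val
        dist_triangle := by
          intro u v w
          have hnnu : ∀ u v : List A, 0 ≤ wdist val u v := fun u v => hnn _ (hρS u v)
          by_cases h1 : wdist val u v = 0
          · have := wdist_eq val hval h1
            subst this
            have := hnnu u u
            linarith
          by_cases h2 : wdist val v w = 0
          · have := wdist_eq val hval h2
            subst this
            have := hnnu v v
            linarith
          by_cases h3 : wdist val u w = 0
          · rw [h3]
            exact add_nonneg (hnnu _ _) (hnnu _ _)
          have e1 := hS2 _ (hρS u v) h1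
          have e2 := hS2 _ (hρS v w) h2
          have e3 := hS2 _ (hρS u w) h3
          linarith [e1.1, e2.1, e3.2]
        eq_of_dist_eq_zero := fun h => wdist_eq val hval h }
    obtain ⟨i, hi⟩ := embed_countable (X := List A) S (fun M _ h1 h2 => huniv M h1 h2) hultra hρS
    exact ⟨i, fun u v => hi.dist_eq u v⟩
  obtain ⟨E, hE⟩ : ∃ E : U → List A, ∀ u v, wdist val (E u) (E v) = dist u v := by
    obtain ⟨dU⟩ := nonempty_denumerable U
    let e : U ≃ ℕ := Denumerable.eqv U
    let toA : ℝ → A := fun r => if h : r ∈ S ∧ r ≠ 0 then ⟨r, h⟩ else default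
    have htoA : ∀ u v : U, u ≠ v → val (toA (dist u v)) = dist u v := by
      intro u v huv
      have : dist u v ∈ S ∧ dist u v ≠ 0 := ⟨hUS u v, dist_ne_zero.2 huv⟩
      simp only [toA, dif_pos this, val]
    let E : U → List A := fun u => (List.range (e u)).map (fun j => toA (dist (e.symm j) u))
    have hEl : ∀ u, (E u).length = e u := fun u => by simp [E]
    have hlt : ∀ u v, e u < e v → wdist val (E u) (E v) = dist u v := by
      intro u v huv
      have hne : E u ≠ E v := by
        intro h
        have := congrArg List.length h
        rw [hEl, hEl] at this
        omega
      have hne2 : u ≠ v := by rintro rfl; omega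
      unfold wdist
      rw [if_neg hne, hEl, hEl, if_pos huv, ← htoA u v hne2]
      simp [E, huv]
    refine ⟨E, fun u v => ?_⟩
    rcases lt_trichotomy (e u) (e v) with h | h | h
    · exact hlt u v h
    · have := e.injective h
      subst this
      simp [wdist]
    · rw [wdist_comm, hlt v u h, dist_comm]
  obtain ⟨K, hK⟩ := exists_envelope (M := M) (A := A)
  let B : Type := M → {l : List A // l.length ≤ K}
  have hBfin1 : Finite {l : List A // l.length ≤ K} := List.finite_length_le A K
  have hBfin : Finite B := Pi.finite
  have hBne : Nonempty B := ⟨fun _ => ⟨[], by simp⟩⟩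
  refine ⟨Nat.card B, Nat.card_pos, fun k hk χ => ?_⟩
  classical
  let g : List ℕ → B → M → U := fun u b j =>
    i ((u.takeWhile (· < (b j).1.length)).map (fun n => (b j).1.getD n default))
  let col : List ℕ → B → Fin k := fun u b =>
    if h : Isometry (g u b) then χ ⟨g u b, h⟩ else ⟨0, by omega⟩
  obtain ⟨W, h, hW, hc⟩ := carlson_simpson_s16 K col
  obtain ⟨u0, hu0, -⟩ := Rigid.nil.pad (Nat.zero_le K)
  have hw : Isometry (fun x => i (pwAct W h (E x))) := by
    apply Isometry.of_dist_eq
    intro x y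
    rw [hi, wdist_act val hW, hE]
  refine ⟨⟨_, hw⟩, ?_⟩
  have hsub : (χ '' {p | ∃ f₀ : {f : M → U // Isometry f},
      p.val = (fun x => i (pwAct W h (E x))) ∘ f₀.val}) ⊆
      (col (pwAct W h u0)) '' Set.univ := by
    rintro _ ⟨p, ⟨f₀, hp⟩, rfl⟩
    obtain ⟨u, b, hu, hb, hab⟩ := hK (fun j => E (f₀.val j))
    let b' : B := fun j => ⟨b j, hb j⟩
    refine ⟨b', Set.mem_univ _, ?_⟩
    rw [hc u0 u hu0 hu]
    have hpg : p.val = g (pwAct W h u) b' := by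
      rw [hp]
      funext j
      simp only [Function.comp, g, b']
      rw [pwAct_takeWhile hW, pwAct_map hW, ← hab j]
    have hiso : Isometry (g (pwAct W h u) b') := hpg ▸ p.2
    simp only [col]
    rw [dif_pos hiso]
    congr 1
    exact Subtype.ext hpg.symm
  calc _ ≤ ((col (pwAct W h u0)) '' Set.univ).ncard := Set.ncard_le_ncard hsub (Set.toFinite _)
    _ ≤ (Set.univ : Set B).ncard := Set.ncard_image_le (Set.toFinite _)
    _ = Nat.card B := Set.ncard_univ B
end
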